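/- arXiv:2006.09934 — 2 statements merged into one kernel-verified Lean document; each statement's English description precedes it below -/
import Mathlib

section
/- Let f be a proper log-concave function on ℝ^d. Then there exist A ∈ ℝ^{d×d} positive definite, α > 0 and a ∈ ℝ^d such that: (1) α·χ_{A B^d + a}(x) ≤ f(x) for all x ∈ ℝ^d; (2) for every open neighborhood U in ℝ^d of the boundary of A B^d + a, the John s-functions J_s f converge uniformly to α·χ_{A B^d + a} on ℝ^d \ U as s → 0⁺; (3) α·χ_{A B^d + a} is the unique flat ellipsoid function of maximal integral among all flat ellipsoid functions that are pointwise ≤ f. -/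
open MeasureTheory
open scoped BigOperators RealInnerProductSpace

noncomputable section

/-- `ℝ^d` with the Euclidean structure. -/
abbrev Ed (d : ℕ) := EuclideanSpace ℝ (Fin d)

/-- `f : ℝ^d → [0,∞)` is log-concave, i.e. `f = e^{-ψ}` for some convex
`ψ : ℝ^d → ℝ ∪ {∞}`; equivalently, `f ≥ 0` and
`f(tx+(1-t)y) ≥ f(x)^t f(y)^{1-t}`. -/
def IsLogConcave {d : ℕ} (f : Ed d → ℝ) : Prop :=
  (∀ x, 0 ≤ f x) ∧
    ∀ x y : Ed d, ∀ t : ℝ, 0 ≤ t → t ≤ 1 →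
      f x ^ t * f y ^ (1 - t) ≤ f (t • x + (1 - t) • y)

/-- A proper log-concave function: log-concave, upper semicontinuous,
with positive finite integral. -/
def ProperLogConcave {d : ℕ} (f : Ed d → ℝ) : Prop :=
  IsLogConcave f ∧ UpperSemicontinuous f ∧
    0 < ∫⁻ x, ENNReal.ofReal (f x) ∧ (∫⁻ x, ENNReal.ofReal (f x)) < ⊤

/-- The `s`-lifting of `f`, a subset of `ℝ^d × ℝ = ℝ^{d+1}`. -/
def sLift {d : ℕ} (s : ℝ) (f : Ed d → ℝ) : Set (Ed d × ℝ) :=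
  {p | |p.2| ≤ f p.1 ^ (1 / s)}

/-- The `d`-symmetric ellipsoid `(A⊕α)B^{d+1} + a` in `ℝ^{d+1} = ℝ^d × ℝ`. -/
def ellE {d : ℕ} (A : Matrix (Fin d) (Fin d) ℝ) (α : ℝ) (a : Ed d) : Set (Ed d × ℝ) :=
  {p | ∃ y : Ed d, ∃ t : ℝ, ‖y‖ ^ 2 + t ^ 2 ≤ 1 ∧
        p.1 = Matrix.toEuclideanLin A y + a ∧ p.2 = α * t}

/-- The closed Euclidean unit ball `B^{d+1}` of `ℝ^{d+1} = ℝ^d × ℝ`. -/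
def unitBallE (d : ℕ) : Set (Ed d × ℝ) := {p | ‖p.1‖ ^ 2 + p.2 ^ 2 ≤ 1}

/-- `κ_s = ∫_{B^d} (1-|x|²)^{s/2} dx`. -/
def kappa (d : ℕ) (s : ℝ) : ℝ :=
  ∫ x in Metric.closedBall (0 : Ed d) 1, (1 - ‖x‖ ^ 2) ^ (s / 2)

/-- The `s`-volume of the ellipsoid represented by `(A⊕α, a)`:
`μ_s = κ_s α^s det A`. -/
def svol {d : ℕ} (s : ℝ) (A : Matrix (Fin d) (Fin d) ℝ) (α : ℝ) : ℝ :=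
  kappa d s * α ^ s * A.det

/-- `(A, α, a)` represents the John `s`-ellipsoid of `f`: it is a d-symmetric
ellipsoid contained in the `s`-lifting of `f` of maximal `s`-volume. -/
def IsJohn {d : ℕ} (s : ℝ) (f : Ed d → ℝ)
    (A : Matrix (Fin d) (Fin d) ℝ) (α : ℝ) (a : Ed d) : Prop :=
  A.PosDef ∧ 0 < α ∧ ellE A α a ⊆ sLift s f ∧
    ∀ (A' : Matrix (Fin d) (Fin d) ℝ) (α' : ℝ) (a' : Ed d),
      A'.PosDef → 0 < α' → ellE A' α' a' ⊆ sLift s f → svol s A' α' ≤ svol s A α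

/-- The height function of the ellipsoid represented by `(A⊕α, a)`. -/
def heightFn {d : ℕ} (A : Matrix (Fin d) (Fin d) ℝ) (α : ℝ) (a : Ed d) (x : Ed d) : ℝ :=
  if ‖Matrix.toEuclideanLin A⁻¹ (x - a)‖ ≤ 1 then
    α * Real.sqrt (1 - ‖Matrix.toEuclideanLin A⁻¹ (x - a)‖ ^ 2)
  else 0

/-- A point of `ℝ^d × ℝ` as a vector in `ℝ^{d+1}`. -/
def augVec {d : ℕ} (p : Ed d × ℝ) : Fin (d + 1) → ℝ :=
  Fin.snoc (fun i => p.1 i) p.2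

/-- The block-diagonal matrix `A ⊕ α`. -/
def matAug {d : ℕ} (A : Matrix (Fin d) (Fin d) ℝ) (α : ℝ) :
    Matrix (Fin (d + 1)) (Fin (d + 1)) ℝ :=
  Matrix.of fun i j =>
    Fin.lastCases (Fin.lastCases α (fun _ => 0) j)
      (fun i' => Fin.lastCases 0 (fun j' => A i' j') j) i

/-- The Frobenius norm of a real matrix. -/
def frobNorm {n : ℕ} (M : Matrix (Fin n) (Fin n) ℝ) : ℝ :=
  Real.sqrt (∑ i, ∑ j, M i j ^ 2)

/-- Asplund sum (sup-convolution) of two functions. -/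
def asplund {d : ℕ} (f g : Ed d → ℝ) : Ed d → ℝ :=
  fun x => ⨆ y : Ed d, f y * g (x - y)

/-- Epi-product `(λ ∗ f)(x) = f(x/λ)^λ`. -/
def epiProd {d : ℕ} (l : ℝ) (f : Ed d → ℝ) : Ed d → ℝ :=
  fun x => f (l⁻¹ • x) ^ l

/-- The flat ellipsoid function `α · χ_{A B^d + a}`. -/
def flatFn {d : ℕ} (A : Matrix (Fin d) (Fin d) ℝ) (α : ℝ) (a : Ed d) (x : Ed d) : ℝ :=
  if ‖Matrix.toEuclideanLin A⁻¹ (x - a)‖ ≤ 1 then α else 0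

/-- The Gaussian density `G[(A⊕α, a)](x) = α e^{−|A^{-1}(x−a)|²}`. -/
def gaussFn {d : ℕ} (A : Matrix (Fin d) (Fin d) ℝ) (α : ℝ) (a : Ed d) (x : Ed d) : ℝ :=
  α * Real.exp (-‖Matrix.toEuclideanLin A⁻¹ (x - a)‖ ^ 2)

/-- Operator (`ℓ₂ → ℓ₂`) norm of a matrix. -/
def opNorm {d : ℕ} (M : Matrix (Fin d) (Fin d) ℝ) : ℝ :=
  ‖Matrix.toEuclideanCLM (𝕜 := ℝ) M‖

/-- `g` is the John `s`-function of `f`. -/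
def IsJohnFn {d : ℕ} (s : ℝ) (f g : Ed d → ℝ) : Prop :=
  ∃ (A : Matrix (Fin d) (Fin d) ℝ) (α : ℝ) (a : Ed d),
    IsJohn s f A α a ∧ g = fun x => heightFn A α a x ^ s

section MatrixLemmas

open Matrix

variable {n : Type*} [Fintype n] [DecidableEq n]

/-- `det N ≤ det ((1 + N) / 2) ^ 2` for positive definite `N`, with equality only at `N = 1`. -/
lemma Matrix.PosDef.det_midpoint_one {N : Matrix n n ℝ} (hN : N.PosDef) :
    N.det ≤ ((1 / 2 : ℝ) • (1 + N)).det ^ 2 ∧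
      (N.det = ((1 / 2 : ℝ) • (1 + N)).det ^ 2 → N = 1) := by
  set l := hN.1.eigenvalues with hl
  have hpos : ∀ i, 0 < l i := hN.eigenvalues_pos
  have hdet : N.det = ∏ i, l i := by simpa using hN.1.det_eq_prod_eigenvalues
  have hspec := hN.1.spectral_theorem
  have hmid : ((1 / 2 : ℝ) • (1 + N)).det ^ 2 = ∏ i, ((1 + l i) / 2) ^ 2 := by
    have : (1 / 2 : ℝ) • (1 + N) =
        (Unitary.conjStarAlgAut ℝ (Matrix n n ℝ)) hN.1.eigenvectorUnitary
          (Matrix.diagonal fun i => (1 + l i) / 2) := by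
      have hd : (Matrix.diagonal fun i => (1 + l i) / 2) =
          (1 / 2 : ℝ) • ((1 : Matrix n n ℝ) +
            Matrix.diagonal (RCLike.ofReal ∘ hN.1.eigenvalues : n → ℝ)) := by
        ext i j
        by_cases hij : i = j
        · subst hij; simp [hl]; ring
        · simp [hij]
      rw [hd, map_smul, map_add, map_one, ← hspec]
    rw [this, Unitary.conjStarAlgAut_apply, Matrix.det_mul_right_comm]
    simp [Finset.prod_pow]
  have hle : ∀ i, l i ≤ ((1 + l i) / 2) ^ 2 := fun i => by nlinarith [sq_nonneg (1 - l i)]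
  rw [hmid, hdet]
  refine ⟨Finset.prod_le_prod (fun i _ => (hpos i).le) fun i _ => hle i, fun heq => ?_⟩
  have hone : ∀ i, l i = 1 := by
    by_contra! hne
    obtain ⟨i, hi⟩ := hne
    refine absurd heq (Finset.prod_lt_prod (fun i _ => hpos i) (fun i _ => hle i)
      ⟨i, Finset.mem_univ i, ?_⟩).ne
    nlinarith [sq_pos_of_ne_zero (sub_ne_zero.2 hi)]
  rw [hspec]
  have : (RCLike.ofReal ∘ hN.1.eigenvalues : n → ℝ) = fun _ => 1 := by
    ext i; simpa [hl] using hone i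
  rw [this, Matrix.diagonal_one, map_one]

/-- Midpoint log-concavity of the determinant, with its equality case. -/
lemma Matrix.PosDef.det_midpoint {A B : Matrix n n ℝ} (hA : A.PosDef) (hB : B.PosDef) :
    A.det * B.det ≤ ((1 / 2 : ℝ) • (A + B)).det ^ 2 ∧
      (A.det * B.det = ((1 / 2 : ℝ) • (A + B)).det ^ 2 → A = B) := by
  obtain ⟨C, hC⟩ : ∃ C : Matrix n n ℝ, A = Cᴴ * C := by
    open scoped MatrixOrder in
    exact CStarAlgebra.nonneg_iff_eq_star_mul_self.mp hA.posSemidef.nonneg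
  have hCd : C.det ≠ 0 := by
    intro h
    have := hA.det_pos
    rw [hC, Matrix.det_mul, h, mul_zero] at this
    exact lt_irrefl _ this
  have hCu : IsUnit C.det := hCd.isUnit
  have hCHu : IsUnit Cᴴ.det := by
    rw [Matrix.det_conjTranspose]; exact hCu.star
  set N := (C⁻¹)ᴴ * B * C⁻¹ with hN
  have hNpd : N.PosDef := hB.conjTranspose_mul_mul_same
    (Matrix.mulVec_injective_iff_isUnit.2 ((Matrix.isUnit_iff_isUnit_det _).2
      (Matrix.isUnit_nonsing_inv_det C hCu)))
  have hBN : B = Cᴴ * N * C := by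
    rw [hN, Matrix.conjTranspose_nonsing_inv]
    simp only [Matrix.mul_assoc]
    rw [Matrix.nonsing_inv_mul _ hCu, Matrix.mul_one, Matrix.mul_nonsing_inv_cancel_left _ _ hCHu]
  have hmid : (1 / 2 : ℝ) • (A + B) = Cᴴ * ((1 / 2 : ℝ) • (1 + N)) * C := by
    rw [hC, hBN]
    simp only [Matrix.mul_smul, Matrix.smul_mul, Matrix.mul_add, Matrix.add_mul, Matrix.mul_one]
  have hdC : Cᴴ.det = C.det := by simp
  have hdA : A.det = C.det ^ 2 := by rw [hC, Matrix.det_mul, hdC]; ring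
  have hdB : B.det = C.det ^ 2 * N.det := by
    rw [hBN, Matrix.det_mul, Matrix.det_mul, hdC]; ring
  have hdM : ((1 / 2 : ℝ) • (A + B)).det = C.det ^ 2 * ((1 / 2 : ℝ) • (1 + N)).det := by
    rw [hmid, Matrix.det_mul, Matrix.det_mul, hdC]; ring
  have h4 : 0 < C.det ^ 4 := by positivity
  obtain ⟨h1, h2⟩ := hNpd.det_midpoint_one
  rw [hdA, hdB, hdM]
  refine ⟨by nlinarith, fun h => ?_⟩
  have : N = 1 := h2 (mul_left_cancel₀ h4.ne' (by linarith))
  rw [hBN, this, Matrix.mul_one, hC]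

/-- Stretching a positive definite matrix along a nonzero vector strictly increases its
determinant. -/
lemma Matrix.PosDef.stretch {A : Matrix n n ℝ} (hA : A.PosDef) {c : ℝ} (hc : 0 ≤ c)
    (v : n → ℝ) :
    (A + c • Matrix.vecMulVec v v).PosDef ∧
      (A + c • Matrix.vecMulVec v v).det = A.det * (1 + c * (v ⬝ᵥ A⁻¹ *ᵥ v)) := by
  constructor
  · have := (Matrix.posSemidef_vecMulVec_self_star v).smul hc
    simpa using hA.add_posSemidef this
  · have := Matrix.det_add_replicateCol_mul_replicateRow (ι := Unit) (A := A)
      hA.det_pos.ne'.isUnit (c • v) v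
    rw [← Matrix.vecMulVec_eq, Matrix.smul_vecMulVec] at this
    rw [this]
    congr 1
    rw [Matrix.det_unique]
    simp [Matrix.mul_assoc, Matrix.mul_apply, dotProduct, mulVec, Finset.mul_sum]

end MatrixLemmas

/-- The positive semidefinite matrices form a closed set. -/
lemma Matrix.isClosed_setOf_posSemidef {n : Type*} [Fintype n] :
    IsClosed {A : Matrix n n ℝ | A.PosSemidef} := by
  simp only [Matrix.posSemidef_iff_dotProduct_mulVec, Set.ofPred_and, Set.ofPred_forall]
  refine IsClosed.inter ?_ (isClosed_iInter fun x => ?_)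
  · exact isClosed_eq (Continuous.matrix_conjTranspose continuous_id) continuous_id
  · exact isClosed_le continuous_const (by fun_prop)

section FlatBelow

open Matrix

variable {d : ℕ} {f : Ed d → ℝ}

/-- The flat ellipsoid function `β · χ_{A B^d + a}` lies below `f`. -/
def FlatBelow (f : Ed d → ℝ) (A : Matrix (Fin d) (Fin d) ℝ) (β : ℝ) (a : Ed d) : Prop :=
  ∀ y : Ed d, ‖y‖ ≤ 1 → β ≤ f (Matrix.toEuclideanLin A y + a)

lemma toEuclideanLin_inv_apply {A : Matrix (Fin d) (Fin d) ℝ} (hA : A.PosDef) (x : Ed d) :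
    Matrix.toEuclideanLin A⁻¹ (Matrix.toEuclideanLin A x) = x := by
  rw [← LinearMap.comp_apply, ← Matrix.toLpLin_mul_same,
    Matrix.nonsing_inv_mul _ hA.det_pos.ne'.isUnit, Matrix.toLpLin_one, LinearMap.id_apply]

lemma toEuclideanLin_apply_inv {A : Matrix (Fin d) (Fin d) ℝ} (hA : A.PosDef) (x : Ed d) :
    Matrix.toEuclideanLin A (Matrix.toEuclideanLin A⁻¹ x) = x := by
  rw [← LinearMap.comp_apply, ← Matrix.toLpLin_mul_same,
    Matrix.mul_nonsing_inv _ hA.det_pos.ne'.isUnit, Matrix.toLpLin_one, LinearMap.id_apply]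

lemma continuous_toEuclideanLin (A : Matrix (Fin d) (Fin d) ℝ) :
    Continuous (Matrix.toEuclideanLin A) :=
  LinearMap.continuous_of_finiteDimensional _

lemma flatFn_le_iff (hf : ∀ x, 0 ≤ f x) {A : Matrix (Fin d) (Fin d) ℝ} (hA : A.PosDef)
    {β : ℝ} {a : Ed d} : (∀ x, flatFn A β a x ≤ f x) ↔ FlatBelow f A β a := by
  constructor
  · intro h y hy
    have := h (Matrix.toEuclideanLin A y + a)
    rwa [flatFn, add_sub_cancel_right, toEuclideanLin_inv_apply hA, if_pos hy] at this
  · intro h x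
    unfold flatFn
    split_ifs with hx
    · have := h _ hx
      rwa [toEuclideanLin_apply_inv hA, sub_add_cancel] at this
    · exact hf x

lemma isClosed_ellipsoid (A : Matrix (Fin d) (Fin d) ℝ) (a : Ed d) :
    IsClosed {x : Ed d | ‖Matrix.toEuclideanLin A⁻¹ (x - a)‖ ≤ 1} :=
  isClosed_le ((continuous_toEuclideanLin A⁻¹).comp (by fun_prop)).norm continuous_const

lemma volume_ellipsoid {A : Matrix (Fin d) (Fin d) ℝ} (hA : A.PosDef) (a : Ed d) :
    volume {x : Ed d | ‖Matrix.toEuclideanLin A⁻¹ (x - a)‖ ≤ 1} =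
      ENNReal.ofReal A.det * volume (Metric.closedBall (0 : Ed d) 1) := by
  have hdet : LinearMap.det (Matrix.toEuclideanLin A⁻¹) = A.det⁻¹ := by
    rw [Matrix.toEuclideanLin, Matrix.toLpLin_eq_toLin, LinearMap.det_toLin,
      Matrix.det_nonsing_inv, Ring.inverse_eq_inv']
  have h1 : {x : Ed d | ‖Matrix.toEuclideanLin A⁻¹ (x - a)‖ ≤ 1} =
      (fun x => x + -a) ⁻¹' ((Matrix.toEuclideanLin A⁻¹) ⁻¹' Metric.closedBall 0 1) := by
    ext x; simp [sub_eq_add_neg]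
  rw [h1, measure_preimage_add_right, Measure.addHaar_preimage_linearMap, hdet, inv_inv,
    abs_of_pos hA.det_pos]
  rw [hdet]; exact inv_ne_zero hA.det_pos.ne'

lemma volume_closedBall_pos (d : ℕ) : 0 < volume.real (Metric.closedBall (0 : Ed d) 1) :=
  ENNReal.toReal_pos (Metric.measure_closedBall_pos _ _ one_pos).ne' measure_closedBall_lt_top.ne

lemma flatFn_eq_indicator (A : Matrix (Fin d) (Fin d) ℝ) (β : ℝ) (a : Ed d) :
    flatFn A β a =
      {x : Ed d | ‖Matrix.toEuclideanLin A⁻¹ (x - a)‖ ≤ 1}.indicator fun _ => β := by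
  classical
  ext x
  simp [flatFn, Set.indicator_apply]

lemma integral_flatFn {A : Matrix (Fin d) (Fin d) ℝ} (hA : A.PosDef) (β : ℝ) (a : Ed d) :
    ∫ x, flatFn A β a x = β * A.det * volume.real (Metric.closedBall (0 : Ed d) 1) := by
  rw [flatFn_eq_indicator, integral_indicator_const _ (isClosed_ellipsoid A a).measurableSet,
    measureReal_def, volume_ellipsoid hA, ENNReal.toReal_mul,
    ENNReal.toReal_ofReal hA.det_pos.le, smul_eq_mul, measureReal_def]
  ring

/-- The volume of a flat ellipsoid function below `f` is bounded by the integral of `f`. -/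
lemma FlatBelow.mul_det_le (hfin : ∫⁻ x, ENNReal.ofReal (f x) < ⊤)
    {A : Matrix (Fin d) (Fin d) ℝ} (hA : A.PosDef) {β : ℝ} {a : Ed d} (hβ : 0 ≤ β)
    (h : FlatBelow f A β a) :
    β * A.det ≤ (∫⁻ x, ENNReal.ofReal (f x)).toReal /
      volume.real (Metric.closedBall (0 : Ed d) 1) := by
  rw [le_div_iff₀ (volume_closedBall_pos d), ← ENNReal.ofReal_le_iff_le_toReal hfin.ne]
  calc ENNReal.ofReal (β * A.det * volume.real (Metric.closedBall (0 : Ed d) 1))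
      = ∫⁻ x, {x : Ed d | ‖Matrix.toEuclideanLin A⁻¹ (x - a)‖ ≤ 1}.indicator
          (fun _ => ENNReal.ofReal β) x := by
        rw [lintegral_indicator_const (isClosed_ellipsoid A a).measurableSet,
          volume_ellipsoid hA, ENNReal.ofReal_mul (mul_nonneg hβ hA.det_pos.le),
          ENNReal.ofReal_mul hβ, measureReal_def,
          ENNReal.ofReal_toReal measure_closedBall_lt_top.ne, mul_assoc]
    _ ≤ ∫⁻ x, ENNReal.ofReal (f x) := by
        refine lintegral_mono fun x => Set.indicator_apply_le' (fun hx => ?_) fun _ => zero_le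
        refine ENNReal.ofReal_le_ofReal ?_
        have := h _ hx
        rwa [toEuclideanLin_apply_inv hA, sub_add_cancel] at this

lemma IsLogConcave.convex_superlevel (hf : IsLogConcave f) (β : ℝ) :
    Convex ℝ {x | β ≤ f x} := by
  intro x hx y hy s t hs ht hst
  rcases le_or_gt β 0 with hβ | hβ
  · exact hβ.trans (hf.1 _)
  have ht' : t = 1 - s := by linarith
  subst ht'
  refine le_trans ?_ (hf.2 x y s hs (by linarith))
  calc β = β ^ s * β ^ (1 - s) := by rw [← Real.rpow_add hβ]; simp
    _ ≤ f x ^ s * f y ^ (1 - s) := by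
      have hx' : β ≤ f x := hx
      have hy' : β ≤ f y := hy
      have := Real.rpow_nonneg (hf.1 x) s
      gcongr

/-- Geometric-mean combination of two flat ellipsoid functions below a log-concave function. -/
lemma FlatBelow.midpoint (hf : IsLogConcave f) {A₁ A₂ : Matrix (Fin d) (Fin d) ℝ} {β₁ β₂ : ℝ}
    {a₁ a₂ : Ed d} (h₁ : FlatBelow f A₁ β₁ a₁) (h₂ : FlatBelow f A₂ β₂ a₂) (hβ₁ : 0 ≤ β₁)
    (hβ₂ : 0 ≤ β₂) :
    FlatBelow f ((1 / 2 : ℝ) • (A₁ + A₂)) (√(β₁ * β₂)) ((1 / 2 : ℝ) • (a₁ + a₂)) := by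
  intro y hy
  have key := hf.2 (Matrix.toEuclideanLin A₁ y + a₁) (Matrix.toEuclideanLin A₂ y + a₂)
    (1 / 2) (by norm_num) (by norm_num)
  have heq : (1 / 2 : ℝ) • (Matrix.toEuclideanLin A₁ y + a₁) +
      (1 - 1 / 2 : ℝ) • (Matrix.toEuclideanLin A₂ y + a₂) =
      Matrix.toEuclideanLin ((1 / 2 : ℝ) • (A₁ + A₂)) y + (1 / 2 : ℝ) • (a₁ + a₂) := by
    simp only [map_smul, map_add, LinearMap.smul_apply, LinearMap.add_apply]
    norm_num
    abel
  rw [heq] at key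
  refine le_trans ?_ key
  rw [Real.sqrt_eq_rpow, Real.mul_rpow hβ₁ hβ₂, show (1 - 1 / 2 : ℝ) = 1 / 2 by norm_num]
  have h₁' := h₁ y hy
  have h₂' := h₂ y hy
  have := Real.rpow_nonneg (hf.1 (Matrix.toEuclideanLin A₁ y + a₁)) (1 / 2)
  gcongr

lemma toEuclideanLin_vecMulVec (v y : Ed d) :
    Matrix.toEuclideanLin (Matrix.vecMulVec v v) y = (inner ℝ v y) • v := by
  ext i
  simp [Matrix.toLpLin_apply, Matrix.mulVec, dotProduct, Matrix.vecMulVec_apply, PiLp.inner_apply,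
    mul_comm, mul_assoc, Finset.mul_sum]

/-- Two translates of a flat ellipsoid function below `f` give a stretched one below `f`. -/
lemma FlatBelow.stretch (hf : ∀ β, Convex ℝ {x | β ≤ f x}) {A : Matrix (Fin d) (Fin d) ℝ} {β : ℝ}
    {m v : Ed d} (h₁ : FlatBelow f A β (m + v)) (h₂ : FlatBelow f A β (m - v)) :
    FlatBelow f (A + ‖v‖⁻¹ • Matrix.vecMulVec v v) β m := by
  intro y hy
  set c : ℝ := ‖v‖⁻¹ * inner ℝ v y with hc
  have hc1 : |c| ≤ 1 := by
    rw [hc, abs_mul, abs_of_nonneg (inv_nonneg.2 (norm_nonneg v))]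
    rcases eq_or_ne ‖v‖ 0 with hv | hv
    · simp [hv]
    · have hvp : 0 < ‖v‖ := lt_of_le_of_ne (norm_nonneg v) hv.symm
      rw [inv_mul_le_iff₀ hvp]
      exact (abs_real_inner_le_norm v y).trans (by gcongr)
  obtain ⟨hc2, hc3⟩ := abs_le.1 hc1
  have := hf β (h₁ y hy) (h₂ y hy) (a := (1 + c) / 2) (b := (1 - c) / 2)
    (by linarith) (by linarith) (by ring)
  simp only [Set.mem_ofPred_eq] at this
  convert this using 2
  rw [map_add, map_smul, LinearMap.add_apply, LinearMap.smul_apply, toEuclideanLin_vecMulVec,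
    smul_smul, ← hc]
  module

lemma dotProduct_self_eq_norm_sq (v : Ed d) : (v : Fin d → ℝ) ⬝ᵥ v = ‖v‖ ^ 2 := by
  rw [← real_inner_self_eq_norm_sq]
  rw [PiLp.inner_apply]
  simp [dotProduct, sq]

end FlatBelow

section Compactness

open Matrix

variable {d : ℕ} {f : Ed d → ℝ}

lemma posDef_smul_one {ρ : ℝ} (hρ : 0 < ρ) : (ρ • (1 : Matrix (Fin d) (Fin d) ℝ)).PosDef :=
  Matrix.PosDef.one.smul hρ

lemma toEuclideanLin_smul_one (ρ : ℝ) (y : Ed d) :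
    Matrix.toEuclideanLin (ρ • (1 : Matrix (Fin d) (Fin d) ℝ)) y = ρ • y := by
  rw [map_smul, LinearMap.smul_apply, Matrix.toLpLin_one, LinearMap.id_apply]

lemma ProperLogConcave.exists_flatBelow_ball (hf : ProperLogConcave f) :
    ∃ ρ : ℝ, 0 < ρ ∧ ∃ β : ℝ, 0 < β ∧ ∃ a, FlatBelow f (ρ • (1 : Matrix (Fin d) (Fin d) ℝ)) β a := by
  obtain ⟨hlc, -, hpos, -⟩ := hf
  obtain ⟨n, hn⟩ : ∃ n : ℕ, volume {x | 1 / ((n : ℝ) + 1) ≤ f x} ≠ 0 := by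
    by_contra! h
    have h0 : volume (⋃ n : ℕ, {x | 1 / ((n : ℝ) + 1) ≤ f x}) = 0 := measure_iUnion_null h
    refine hpos.ne' ?_
    rw [← lintegral_zero (μ := volume (α := Ed d))]
    refine lintegral_congr_ae ?_
    filter_upwards [measure_eq_zero_iff_ae_notMem.1 h0] with x hx
    simp only [ENNReal.ofReal_eq_zero]
    by_contra! hfx
    obtain ⟨n, hn⟩ := exists_nat_one_div_lt hfx
    exact hx (Set.mem_iUnion.2 ⟨n, hn.le⟩)
  set β : ℝ := 1 / ((n : ℝ) + 1)
  have hβ : 0 < β := by positivity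
  have hconv := hlc.convex_superlevel β
  have hint : (interior {x | β ≤ f x}).Nonempty := by
    rw [Set.nonempty_iff_ne_empty]
    intro he
    refine hn (measure_mono_null ?_ (hconv.addHaar_frontier volume))
    rw [frontier, he, Set.sdiff_empty]
    exact subset_closure
  obtain ⟨a, ha⟩ := hint
  obtain ⟨ρ, hρ, hball⟩ := Metric.isOpen_iff.1 isOpen_interior a ha
  refine ⟨ρ / 2, by positivity, β, hβ, a, fun y hy => ?_⟩
  have : Matrix.toEuclideanLin ((ρ / 2) • (1 : Matrix (Fin d) (Fin d) ℝ)) y + a ∈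
      Metric.ball a ρ := by
    rw [toEuclideanLin_smul_one, mem_ball_iff_norm, add_sub_cancel_right, norm_smul,
      Real.norm_of_nonneg (by positivity)]
    nlinarith
  have hmem : _ ∈ {x | β ≤ f x} := interior_subset (hball this)
  exact hmem

lemma ProperLogConcave.isBounded_superlevel (hf : ProperLogConcave f) {β : ℝ} (hβ : 0 < β) :
    Bornology.IsBounded {x | β ≤ f x} := by
  obtain ⟨ρ, hρ, β₀, hβ₀, a₀, h₀⟩ := hf.exists_flatBelow_ball
  have hconv := hf.1.convex_superlevel
  set γ := min β β₀ with hγ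
  have hγ0 : 0 < γ := lt_min hβ hβ₀
  set I := (∫⁻ x, ENNReal.ofReal (f x)).toReal / volume.real (Metric.closedBall (0 : Ed d) 1)
  set r := ρ / 2 with hr
  have hr0 : 0 < r := by positivity
  refine isBounded_iff_forall_norm_le.2 ⟨‖a₀‖ + 4 * (r * (I / (γ * r ^ d))), fun x hx => ?_⟩
  have hx : β ≤ f x := hx
  -- a small ball around `a₀` and one around the midpoint of `a₀` and `x`
  set v : Ed d := (1 / 4 : ℝ) • (x - a₀) with hv
  have h1 : FlatBelow f (r • (1 : Matrix (Fin d) (Fin d) ℝ)) γ ((a₀ + v) - v) := by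
    intro y hy
    have := h₀ ((1 / 2 : ℝ) • y) (by rw [norm_smul]; norm_num; linarith)
    rw [toEuclideanLin_smul_one, smul_smul] at this
    rw [toEuclideanLin_smul_one, add_sub_cancel_right, hr, div_eq_mul_one_div]
    exact (min_le_right _ _).trans this
  have h2 : FlatBelow f (r • (1 : Matrix (Fin d) (Fin d) ℝ)) γ ((a₀ + v) + v) := by
    intro y hy
    have h3 := (min_le_right β β₀).trans (h₀ y hy)
    have h4 := (min_le_left β β₀).trans hx
    rw [toEuclideanLin_smul_one] at h3
    have h5 : γ ≤ f ((1 / 2 : ℝ) • (ρ • y + a₀) + (1 / 2 : ℝ) • x) :=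
      hconv γ h3 h4 (by norm_num) (by norm_num) (by norm_num)
    rw [toEuclideanLin_smul_one]
    convert h5 using 2
    rw [hv, hr]
    module
  have h3 := h2.stretch hconv h1
  obtain ⟨hpd, hdet⟩ := (posDef_smul_one (d := d) hr0).stretch (inv_nonneg.2 (norm_nonneg v)) v
  have h4 := h3.mul_det_le hf.2.2.2 hpd hγ0.le
  have h5 : (v : Fin d → ℝ) ⬝ᵥ (r • (1 : Matrix (Fin d) (Fin d) ℝ))⁻¹ *ᵥ v = r⁻¹ * ‖v‖ ^ 2 := by
    have : (r • (1 : Matrix (Fin d) (Fin d) ℝ))⁻¹ = r⁻¹ • 1 := by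
      refine Matrix.inv_eq_right_inv ?_
      simp [smul_smul, hr0.ne']
    rw [this, Matrix.smul_mulVec, Matrix.one_mulVec, dotProduct_smul, dotProduct_self_eq_norm_sq,
      smul_eq_mul]
  rw [hdet, h5, Matrix.det_smul, Matrix.det_one, Fintype.card_fin] at h4
  have h6 : γ * r ^ d * (r⁻¹ * ‖v‖) ≤ I := by
    have : ‖v‖⁻¹ * (r⁻¹ * ‖v‖ ^ 2) = r⁻¹ * ‖v‖ := by
      rcases eq_or_ne ‖v‖ 0 with h | h
      · simp [h]
      · field_simp
    rw [this] at h4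
    have : 0 < γ * r ^ d := by positivity
    nlinarith
  have h7 : ‖v‖ ≤ r * (I / (γ * r ^ d)) := by
    rw [← inv_mul_le_iff₀ hr0, le_div_iff₀ (by positivity)]
    linarith
  have h8 : x = a₀ + (4 : ℝ) • v := by rw [hv]; module
  calc ‖x‖ = ‖a₀ + (4 : ℝ) • v‖ := congrArg norm h8
    _ ≤ ‖a₀‖ + ‖(4 : ℝ) • v‖ := norm_add_le _ _
    _ = ‖a₀‖ + 4 * ‖v‖ := by rw [norm_smul]; norm_num
    _ ≤ _ := by gcongr

lemma ProperLogConcave.exists_upper_bound (hf : ProperLogConcave f) : ∃ M, ∀ x, f x ≤ M := by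
  obtain ⟨ρ, hρ, β, hβ, a, h⟩ := hf.exists_flatBelow_ball
  have ha : β ≤ f a := by simpa using h 0 (by simp)
  have hcl : IsClosed {x | β ≤ f x} := upperSemicontinuous_iff_isClosed_preimage.1 hf.2.1 β
  obtain ⟨x₀, -, hmax⟩ := (hf.2.1.upperSemicontinuousOn {x | β ≤ f x}).exists_isMaxOn ⟨a, ha⟩
    (Metric.isCompact_of_isClosed_isBounded hcl (hf.isBounded_superlevel hβ))
  refine ⟨f x₀, fun x => ?_⟩
  rcases le_or_gt β (f x) with hx | hx
  · exact hmax hx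
  · exact hx.le.trans (ha.trans (hmax ha))

/-- The flat ellipsoid functions below `f` with (normalized) volume at least `c`. -/
def flatSet (f : Ed d → ℝ) (c : ℝ) : Set (Matrix (Fin d) (Fin d) ℝ × ℝ × Ed d) :=
  {p | p.1.PosSemidef ∧ 0 ≤ p.2.1 ∧ FlatBelow f p.1 p.2.1 p.2.2 ∧ c ≤ p.2.1 * p.1.det}

lemma flatSet.pos {c : ℝ} (hc : 0 < c) {p : Matrix (Fin d) (Fin d) ℝ × ℝ × Ed d}
    (hp : p ∈ flatSet f c) : p.1.PosDef ∧ 0 < p.2.1 := by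
  obtain ⟨h1, h2, -, h4⟩ := hp
  have h5 : p.2.1 * p.1.det ≠ 0 := (hc.trans_le h4).ne'
  exact ⟨h1.posDef_iff_det_ne_zero.2 (right_ne_zero_of_mul h5),
    lt_of_le_of_ne h2 (left_ne_zero_of_mul h5).symm⟩

lemma continuous_toEuclideanLin_apply (y : Ed d) :
    Continuous fun A : Matrix (Fin d) (Fin d) ℝ => Matrix.toEuclideanLin A y := by
  simp only [Matrix.toEuclideanLin, Matrix.toLpLin_apply]
  fun_prop

lemma toEuclideanLin_single_apply (A : Matrix (Fin d) (Fin d) ℝ) (i j : Fin d) :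
    Matrix.toEuclideanLin A (EuclideanSpace.single j 1) i = A i j := by
  simp [Matrix.toLpLin_apply]

lemma isClosed_flatSet (hf : UpperSemicontinuous f) (c : ℝ) : IsClosed (flatSet f c) := by
  unfold flatSet FlatBelow
  simp only [Set.ofPred_and, Set.ofPred_forall]
  refine IsClosed.inter (Matrix.isClosed_setOf_posSemidef.preimage continuous_fst) (IsClosed.inter
    (isClosed_le continuous_const (by fun_prop)) (IsClosed.inter
    (isClosed_iInter fun y => isClosed_iInter fun _ => ?_)
    (isClosed_le continuous_const ?_)))
  · refine (upperSemicontinuous_iff_IsClosed_hypograph.1 hf).preimage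
      (f := fun p : Matrix (Fin d) (Fin d) ℝ × ℝ × Ed d =>
      (Matrix.toEuclideanLin p.1 y + p.2.2, p.2.1)) ?_
    have := (continuous_toEuclideanLin_apply y).comp
      (continuous_fst (X := Matrix (Fin d) (Fin d) ℝ) (Y := ℝ × Ed d))
    exact (this.add (by fun_prop)).prodMk (by fun_prop)
  · exact (by fun_prop : Continuous fun p : Matrix (Fin d) (Fin d) ℝ × ℝ × Ed d => p.2.1).mul
      (continuous_fst.matrix_det)

/-- Lower bound on the height of a flat ellipsoid function below `f` with large volume. -/
lemma ProperLogConcave.exists_height_lower_bound (hf : ProperLogConcave f) {c : ℝ} (hc : 0 < c) :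
    ∃ b > 0, ∀ p ∈ flatSet f c, b ≤ p.2.1 := by
  obtain ⟨ρ, hρ, β₀, hβ₀, a₀, h₀⟩ := hf.exists_flatBelow_ball
  set I := (∫⁻ x, ENNReal.ofReal (f x)).toReal / volume.real (Metric.closedBall (0 : Ed d) 1)
  have hpoint : FlatBelow f (0 : Matrix (Fin d) (Fin d) ℝ) β₀ a₀ := fun y _ => by
    simpa using h₀ 0 (by simp)
  -- contracting towards `a₀`
  have key : ∀ p ∈ flatSet f c, √(p.2.1 * β₀) * ((1 / 2) ^ d * p.1.det) ≤ I := by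
    intro p hp
    obtain ⟨hpd, hpos⟩ := flatSet.pos hc hp
    have h1 := hp.2.2.1.midpoint hf.1 hpoint hpos.le hβ₀.le
    rw [add_zero] at h1
    have h2 := h1.mul_det_le hf.2.2.2 (hpd.smul (by norm_num)) (Real.sqrt_nonneg _)
    rwa [Matrix.det_smul, Fintype.card_fin] at h2
  set κ : ℝ := (1 / 2) ^ d with hκ
  have hκ0 : 0 < κ := by positivity
  have hI : 0 ≤ I := by positivity
  refine ⟨β₀ * (c * κ / (I + 1)) ^ 2, by positivity, fun p hp => ?_⟩
  obtain ⟨hpd, hpos⟩ := flatSet.pos hc hp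
  have h1 := key p hp
  have h2 : c ≤ p.2.1 * p.1.det := hp.2.2.2
  have h3 : √(p.2.1 * β₀) * √(p.2.1 * β₀) = p.2.1 * β₀ := Real.mul_self_sqrt (by positivity)
  set w := √(p.2.1 * β₀) with hw
  have hw0 : 0 < w := Real.sqrt_pos.2 (by positivity)
  have h4 : c * κ * β₀ ≤ w * I := by
    calc c * κ * β₀ ≤ (p.2.1 * p.1.det) * κ * β₀ := by gcongr
      _ = w * (w * (κ * p.1.det)) := by rw [← mul_assoc w w, h3]; ring
      _ ≤ w * I := by gcongr
  have h5 : c * κ / (I + 1) * β₀ ≤ w := by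
    rw [div_mul_eq_mul_div, div_le_iff₀ (by positivity)]
    linarith
  have h6 : (c * κ / (I + 1) * β₀) ^ 2 ≤ w ^ 2 := by gcongr
  refine le_of_mul_le_mul_right ?_ hβ₀
  calc _ = (c * κ / (I + 1) * β₀) ^ 2 := by ring
    _ ≤ w ^ 2 := h6
    _ = _ := by rw [sq, h3]

lemma isCompact_setOf_abs_apply_le (R : ℝ) :
    IsCompact {A : Matrix (Fin d) (Fin d) ℝ | ∀ i j, |A i j| ≤ R} := by
  have : IsCompact (Set.univ.pi fun _ : Fin d => Set.univ.pi fun _ : Fin d => Set.Icc (-R) R) :=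
    isCompact_univ_pi fun _ => isCompact_univ_pi fun _ => isCompact_Icc
  have h : (Set.univ.pi fun _ : Fin d => Set.univ.pi fun _ : Fin d => Set.Icc (-R) R) =
      {A : Fin d → Fin d → ℝ | ∀ i j, |A i j| ≤ R} := by
    ext A
    simp only [Set.mem_pi, Set.mem_univ, true_imp_iff, Set.mem_Icc, Set.mem_ofPred_eq, abs_le]
  rw [h] at this
  exact this

lemma ProperLogConcave.isCompact_flatSet (hf : ProperLogConcave f) {c : ℝ} (hc : 0 < c) :
    IsCompact (flatSet f c) := by
  obtain ⟨b, hb, hbp⟩ := hf.exists_height_lower_bound hc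
  obtain ⟨M, hM⟩ := hf.exists_upper_bound
  obtain ⟨R, hR⟩ := isBounded_iff_forall_norm_le.1 (hf.isBounded_superlevel hb)
  have hK : IsCompact ({A : Matrix (Fin d) (Fin d) ℝ | ∀ i j, |A i j| ≤ 2 * R} ×ˢ
      Set.Icc (0 : ℝ) M ×ˢ Metric.closedBall (0 : Ed d) R) :=
    (isCompact_setOf_abs_apply_le _).prod (isCompact_Icc.prod (isCompact_closedBall _ _))
  refine hK.of_isClosed_subset (isClosed_flatSet hf.2.1 c) fun p hp => ?_
  have hpt : ∀ y : Ed d, ‖y‖ ≤ 1 → ‖Matrix.toEuclideanLin p.1 y + p.2.2‖ ≤ R :=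
    fun y hy => hR _ ((hbp p hp).trans (hp.2.2.1 y hy))
  have h0 : ‖p.2.2‖ ≤ R := by simpa using hpt 0 (by simp)
  refine ⟨fun i j => ?_, ⟨hp.2.1, (hp.2.2.1 0 (by simp)).trans (hM _)⟩, by simpa using h0⟩
  have h1 := hpt (EuclideanSpace.single j 1) (by simp)
  have h2 : ‖Matrix.toEuclideanLin p.1 (EuclideanSpace.single j 1)‖ ≤ 2 * R := by
    have := norm_sub_le (Matrix.toEuclideanLin p.1 (EuclideanSpace.single j 1) + p.2.2) p.2.2
    rw [add_sub_cancel_right] at this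
    linarith
  have h3 := (PiLp.norm_apply_le (Matrix.toEuclideanLin p.1 (EuclideanSpace.single j 1)) i).trans h2
  rw [Real.norm_eq_abs] at h3
  rw [toEuclideanLin_single_apply] at h3
  exact h3

end Compactness

section Maximizer

open Matrix Filter Topology

variable {d : ℕ} {f : Ed d → ℝ}

/-- `(A, β, a)` represents a flat ellipsoid function below `f` of maximal volume. -/
structure IsFlatMax (f : Ed d → ℝ) (A : Matrix (Fin d) (Fin d) ℝ) (β : ℝ) (a : Ed d) : Prop where
  posDef : A.PosDef
  pos : 0 < β
  below : FlatBelow f A β a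
  max : ∀ (A' : Matrix (Fin d) (Fin d) ℝ) (β' : ℝ) (a' : Ed d), A'.PosDef → 0 < β' →
    FlatBelow f A' β' a' → β' * A'.det ≤ β * A.det

lemma continuous_mul_det :
    Continuous fun p : Matrix (Fin d) (Fin d) ℝ × ℝ × Ed d => p.2.1 * p.1.det :=
  (by fun_prop : Continuous fun p : Matrix (Fin d) (Fin d) ℝ × ℝ × Ed d => p.2.1).mul
    (continuous_fst.matrix_det)

lemma ProperLogConcave.exists_isFlatMax (hf : ProperLogConcave f) :
    ∃ A β a, IsFlatMax f A β a := by
  obtain ⟨ρ, hρ, β₀, hβ₀, a₀, h₀⟩ := hf.exists_flatBelow_ball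
  have hpd := posDef_smul_one (d := d) hρ
  set c := β₀ * (ρ • (1 : Matrix (Fin d) (Fin d) ℝ)).det with hc
  have hc0 : 0 < c := mul_pos hβ₀ hpd.det_pos
  obtain ⟨p, hp, hmax⟩ := (hf.isCompact_flatSet hc0).exists_isMaxOn
    ⟨(ρ • 1, β₀, a₀), hpd.posSemidef, hβ₀.le, h₀, le_rfl⟩ continuous_mul_det.continuousOn
  obtain ⟨h1, h2⟩ := flatSet.pos hc0 hp
  refine ⟨p.1, p.2.1, p.2.2, h1, h2, hp.2.2.1, fun A' β' a' hA' hβ' h' => ?_⟩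
  rcases le_or_gt c (β' * A'.det) with h | h
  · exact hmax (show (A', β', a') ∈ flatSet f c from ⟨hA'.posSemidef, hβ'.le, h', h⟩)
  · exact h.le.trans hp.2.2.2

lemma IsFlatMax.unique (hf : IsLogConcave f) {A A' : Matrix (Fin d) (Fin d) ℝ} {β β' : ℝ}
    {a a' : Ed d} (h : IsFlatMax f A β a) (hA' : A'.PosDef) (hβ' : 0 < β')
    (h' : FlatBelow f A' β' a') (heq : β' * A'.det = β * A.det) : A' = A ∧ β' = β ∧ a' = a := by
  have hAA : A' = A := by
    have hpd : ((1 / 2 : ℝ) • (A' + A)).PosDef := (hA'.add h.posDef).smul (by norm_num)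
    have h1 := h.max _ _ _ hpd (Real.sqrt_pos.2 (mul_pos hβ' h.pos))
      (h'.midpoint hf h.below hβ'.le h.pos.le)
    obtain ⟨h2, h3⟩ := hA'.det_midpoint h.posDef
    refine h3 (le_antisymm h2 ?_)
    have h4 := pow_le_pow_left₀
      (mul_nonneg (Real.sqrt_nonneg _) hpd.det_pos.le) h1 2
    rw [mul_pow, Real.sq_sqrt (mul_pos hβ' h.pos).le] at h4
    have h5 : (β * A.det) ^ 2 = β' * β * (A'.det * A.det) := by
      rw [sq]; nth_rewrite 1 [← heq]; ring
    rw [h5] at h4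
    exact le_of_mul_le_mul_left h4 (mul_pos hβ' h.pos)
  subst hAA
  have hββ : β' = β := mul_right_cancel₀ hA'.det_pos.ne' heq
  subst hββ
  refine ⟨rfl, rfl, ?_⟩
  by_contra hne
  set v : Ed d := (1 / 2 : ℝ) • (a' - a) with hv
  have hv0 : v ≠ 0 := smul_ne_zero (by norm_num) (sub_ne_zero.2 hne)
  have hvn : 0 < ‖v‖ := norm_pos_iff.2 hv0
  have h1 : FlatBelow f A' β' ((1 / 2 : ℝ) • (a' + a) + v) := by
    convert h' using 1; rw [hv]; module
  have h2 : FlatBelow f A' β' ((1 / 2 : ℝ) • (a' + a) - v) := by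
    convert h.below using 1; rw [hv]; module
  obtain ⟨h3, h4⟩ := hA'.stretch (inv_nonneg.2 (norm_nonneg v)) v
  have h5 := h.max _ _ _ h3 hβ' (h1.stretch hf.convex_superlevel h2)
  rw [h4] at h5
  have h6 : 0 < (v : Fin d → ℝ) ⬝ᵥ A'⁻¹ *ᵥ v := by
    have := hA'.inv.dotProduct_mulVec_pos (x := (v : Fin d → ℝ)) (by simpa using hv0)
    simpa using this
  have h7 := le_of_mul_le_mul_left h5 hβ'
  have h8 : 0 < A'.det * (‖v‖⁻¹ * ((v : Fin d → ℝ) ⬝ᵥ A'⁻¹ *ᵥ v)) :=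
    mul_pos hA'.det_pos (mul_pos (inv_pos.2 hvn) h6)
  linarith

/-- Flat ellipsoid functions below `f` with asymptotically maximal volume converge to the
maximizer. -/
lemma IsFlatMax.tendsto (hf : ProperLogConcave f) {A : Matrix (Fin d) (Fin d) ℝ} {β : ℝ}
    {a : Ed d} (h : IsFlatMax f A β a) {ι : Type*} {l : Filter ι}
    {T : ι → Matrix (Fin d) (Fin d) ℝ × ℝ × Ed d}
    (hT : ∀ᶠ i in l, (T i).1.PosDef ∧ 0 < (T i).2.1 ∧ FlatBelow f (T i).1 (T i).2.1 (T i).2.2)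
    (hlim : Tendsto (fun i => (T i).2.1 * (T i).1.det) l (𝓝 (β * A.det))) :
    Tendsto T l (𝓝 (A, β, a)) := by
  have hV : 0 < β * A.det := mul_pos h.pos h.posDef.det_pos
  refine (hf.isCompact_flatSet (half_pos hV)).tendsto_nhds_of_unique_mapClusterPt ?_ ?_
  · filter_upwards [hT, hlim.eventually (lt_mem_nhds (half_lt_self hV))] with i hi hi2
    exact ⟨hi.1.posSemidef, hi.2.1.le, hi.2.2, hi2.le⟩
  · intro p hp hcl
    obtain ⟨h1, h2⟩ := flatSet.pos (half_pos hV) hp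
    have h3 : MapClusterPt (p.2.1 * p.1.det) l (fun i => (T i).2.1 * (T i).1.det) :=
      hcl.continuousAt_comp (f := fun p : Matrix (Fin d) (Fin d) ℝ × ℝ × Ed d => p.2.1 * p.1.det)
        continuous_mul_det.continuousAt
    have h4 : p.2.1 * p.1.det = β * A.det := by
      have : (𝓝 (p.2.1 * p.1.det) ⊓ map (fun i => (T i).2.1 * (T i).1.det) l).NeBot := h3
      exact eq_of_nhds_neBot (h3.neBot.mono (inf_le_inf_left _ hlim))
    obtain ⟨e1, e2, e3⟩ := h.unique hf.1 h1 h2 hp.2.2.1 h4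
    exact Prod.ext e1 (Prod.ext e2 e3)

end Maximizer

section JohnFunctions

open Matrix Filter Topology

variable {d : ℕ} {f : Ed d → ℝ}

lemma kappa_pos (d : ℕ) {s : ℝ} (hs : 0 < s) : 0 < kappa d s := by
  have hcont : Continuous fun x : Ed d => (1 - ‖x‖ ^ 2) ^ (s / 2) :=
    (by fun_prop : Continuous fun x : Ed d => 1 - ‖x‖ ^ 2).rpow_const
      fun _ => Or.inr (by positivity)
  have hnn : ∀ x ∈ Metric.closedBall (0 : Ed d) 1, 0 ≤ 1 - ‖x‖ ^ 2 := fun x hx => by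
    rw [mem_closedBall_zero_iff] at hx
    nlinarith [norm_nonneg x]
  rw [kappa, setIntegral_pos_iff_support_of_nonneg_ae]
  · refine (Metric.measure_ball_pos volume (0 : Ed d) one_pos).trans_le (measure_mono fun x hx => ?_)
    refine ⟨?_, Metric.ball_subset_closedBall hx⟩
    rw [mem_ball_zero_iff] at hx
    exact (Real.rpow_pos_of_pos (by nlinarith [norm_nonneg x]) _).ne'
  · filter_upwards [ae_restrict_mem Metric.isClosed_closedBall.measurableSet] with x hx
    exact Real.rpow_nonneg (hnn x hx) _
  · exact hcont.continuousOn.integrableOn_compact (isCompact_closedBall _ _)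

/-- Shrinking a John `s`-ellipsoid gives a flat ellipsoid function below `f`. -/
lemma IsJohn.flatBelow {s : ℝ} (hs : 0 < s) (hf : ∀ x, 0 ≤ f x)
    {A : Matrix (Fin d) (Fin d) ℝ} {α : ℝ} {a : Ed d} (h : IsJohn s f A α a) {r : ℝ} (hr : 0 ≤ r)
    (hr1 : r ≤ 1) : FlatBelow f (r • A) (α ^ s * (1 - r ^ 2) ^ (s / 2)) a := by
  obtain ⟨-, hα, hsub, -⟩ := h
  intro y hy
  have hr2 : 0 ≤ 1 - r ^ 2 := by nlinarith
  have hmem : (Matrix.toEuclideanLin A (r • y) + a, α * √(1 - r ^ 2)) ∈ ellE A α a := by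
    refine ⟨r • y, √(1 - r ^ 2), ?_, rfl, rfl⟩
    rw [Real.sq_sqrt hr2, norm_smul, Real.norm_of_nonneg hr, mul_pow]
    nlinarith [norm_nonneg y, mul_nonneg (sq_nonneg r) (by nlinarith [norm_nonneg y] :
      (0 : ℝ) ≤ 1 - ‖y‖ ^ 2)]
  have h1 : |α * √(1 - r ^ 2)| ≤ f (Matrix.toEuclideanLin A (r • y) + a) ^ (1 / s) := hsub hmem
  rw [abs_of_nonneg (by positivity)] at h1
  have h2 := Real.rpow_le_rpow (by positivity) h1 hs.le
  rw [← Real.rpow_mul (hf _), one_div_mul_cancel hs.ne', Real.rpow_one,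
    Real.mul_rpow hα.le (Real.sqrt_nonneg _), Real.sqrt_eq_rpow, ← Real.rpow_mul hr2] at h2
  rw [map_smul, LinearMap.smul_apply, ← map_smul]
  convert h2 using 3
  ring

lemma IsJohn.le_of_flatBelow {s : ℝ} (hs : 0 < s) {A A₀ : Matrix (Fin d) (Fin d) ℝ} {α β₀ : ℝ}
    {a a₀ : Ed d} (h : IsJohn s f A α a) (hA₀ : A₀.PosDef) (hβ₀ : 0 < β₀)
    (h₀ : FlatBelow f A₀ β₀ a₀) : β₀ * A₀.det ≤ α ^ s * A.det := by
  have hsub : ellE A₀ (β₀ ^ (1 / s)) a₀ ⊆ sLift s f := by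
    rintro ⟨x, t⟩ ⟨y, τ, hyt, rfl, rfl⟩
    have hy : ‖y‖ ≤ 1 := by nlinarith [norm_nonneg y, sq_nonneg τ]
    have hτ : |τ| ≤ 1 := by
      rw [← sq_le_one_iff_abs_le_one]
      nlinarith [sq_nonneg ‖y‖]
    have hp : 0 ≤ β₀ ^ (1 / s) := Real.rpow_nonneg hβ₀.le _
    change |β₀ ^ (1 / s) * τ| ≤ f (Matrix.toEuclideanLin A₀ y + a₀) ^ (1 / s)
    rw [abs_mul, abs_of_nonneg hp]
    exact (mul_le_of_le_one_right hp hτ).trans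
      (Real.rpow_le_rpow hβ₀.le (h₀ y hy) (by positivity))
  have h1 := h.2.2.2 A₀ (β₀ ^ (1 / s)) a₀ hA₀ (Real.rpow_pos_of_pos hβ₀ _) hsub
  rw [svol, svol, ← Real.rpow_mul hβ₀.le, one_div_mul_cancel hs.ne', Real.rpow_one, mul_assoc,
    mul_assoc] at h1
  exact le_of_mul_le_mul_left h1 (kappa_pos d hs)

lemma tendsto_rpow_half_self : Tendsto (fun s : ℝ => s ^ (s / 2)) (𝓝[>] 0) (𝓝 1) := by
  have h1 : Tendsto (fun s : ℝ => Real.exp (s * Real.log s / 2)) (𝓝[>] 0) (𝓝 1) := by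
    have : Continuous fun s : ℝ => Real.exp (s * Real.log s / 2) :=
      Real.continuous_exp.comp (Real.continuous_mul_log.div_const 2)
    simpa using (this.tendsto 0).mono_left nhdsWithin_le_nhds
  refine h1.congr' ?_
  filter_upwards [self_mem_nhdsWithin] with s hs
  rw [Real.rpow_def_of_pos hs]
  ring_nf

/-- The John `s`-ellipsoids, suitably rescaled, converge to the maximal flat ellipsoid. -/
lemma IsFlatMax.tendsto_john (hf : ProperLogConcave f) {A₀ : Matrix (Fin d) (Fin d) ℝ} {β₀ : ℝ}
    {a₀ : Ed d} (h : IsFlatMax f A₀ β₀ a₀) {A : ℝ → Matrix (Fin d) (Fin d) ℝ} {α : ℝ → ℝ}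
    {a : ℝ → Ed d} (hJ : ∀ s, 0 < s → IsJohn s f (A s) (α s) (a s)) :
    Tendsto A (𝓝[>] 0) (𝓝 A₀) ∧ Tendsto (fun s => α s ^ s) (𝓝[>] 0) (𝓝 β₀) ∧
      Tendsto a (𝓝[>] 0) (𝓝 a₀) := by
  set r : ℝ → ℝ := fun s => √(1 - s) with hr
  set w : ℝ → ℝ := fun s => s ^ (s / 2) with hw
  have hr1 : Tendsto r (𝓝[>] 0) (𝓝 1) := by
    have : Continuous r := by fun_prop
    simpa [hr] using (this.tendsto 0).mono_left nhdsWithin_le_nhds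
  have hw1 : Tendsto w (𝓝[>] 0) (𝓝 1) := tendsto_rpow_half_self
  have hIoo : ∀ᶠ s : ℝ in 𝓝[>] 0, 0 < s ∧ s < 1 := Ioo_mem_nhdsGT one_pos
  have hrpos : ∀ᶠ s : ℝ in 𝓝[>] 0, 0 < r s := by
    filter_upwards [hIoo] with s hs
    exact Real.sqrt_pos.2 (by linarith [hs.2])
  have hwpos : ∀ᶠ s : ℝ in 𝓝[>] 0, 0 < w s := by
    filter_upwards [hIoo] with s hs
    exact Real.rpow_pos_of_pos hs.1 _
  set T : ℝ → Matrix (Fin d) (Fin d) ℝ × ℝ × Ed d :=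
    fun s => (r s • A s, α s ^ s * w s, a s) with hT
  have hfeas : ∀ᶠ s : ℝ in 𝓝[>] 0,
      (T s).1.PosDef ∧ 0 < (T s).2.1 ∧ FlatBelow f (T s).1 (T s).2.1 (T s).2.2 := by
    filter_upwards [hIoo, hrpos, hwpos] with s hs hrs hws
    have hj := hJ s hs.1
    refine ⟨hj.1.smul hrs, mul_pos (Real.rpow_pos_of_pos hj.2.1 _) hws, ?_⟩
    have h1 := hj.flatBelow hs.1 hf.1.1 hrs.le (Real.sqrt_le_one.2 (by linarith [hs.1]))
    have h2 : 1 - r s ^ 2 = s := by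
      simp only [hr]
      rw [Real.sq_sqrt (by linarith [hs.2])]
      ring
    rwa [h2] at h1
  have hlim : Tendsto (fun s => (T s).2.1 * (T s).1.det) (𝓝[>] 0) (𝓝 (β₀ * A₀.det)) := by
    have hlow : Tendsto (fun s => r s ^ d * w s * (β₀ * A₀.det)) (𝓝[>] 0)
        (𝓝 (β₀ * A₀.det)) := by
      simpa using ((hr1.pow d).mul hw1).mul_const (β₀ * A₀.det)
    refine tendsto_of_tendsto_of_tendsto_of_le_of_le' hlow tendsto_const_nhds ?_ ?_
    · filter_upwards [hIoo, hrpos, hwpos] with s hs hrs hws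
      have h1 := (hJ s hs.1).le_of_flatBelow hs.1 h.posDef h.pos h.below
      calc r s ^ d * w s * (β₀ * A₀.det) ≤ r s ^ d * w s * (α s ^ s * (A s).det) := by gcongr
        _ = (T s).2.1 * (T s).1.det := by
          simp only [hT, Matrix.det_smul, Fintype.card_fin]; ring
    · filter_upwards [hfeas] with s hs
      exact h.max _ _ _ hs.1 hs.2.1 hs.2.2
  have hmain := h.tendsto hf hfeas hlim
  have hm1 : Tendsto (fun s => r s • A s) (𝓝[>] 0) (𝓝 A₀) :=
    (continuous_fst.tendsto _).comp hmain
  have hm2 : Tendsto (fun s => α s ^ s * w s) (𝓝[>] 0) (𝓝 β₀) :=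
    ((continuous_fst.comp continuous_snd).tendsto _).comp hmain
  have hm3 : Tendsto a (𝓝[>] 0) (𝓝 a₀) :=
    ((continuous_snd.comp continuous_snd).tendsto _).comp hmain
  refine ⟨?_, ?_, hm3⟩
  · have h1 : Tendsto (fun s => (r s)⁻¹ • (r s • A s)) (𝓝[>] 0) (𝓝 A₀) := by
      simpa using (hr1.inv₀ one_ne_zero).smul hm1
    refine h1.congr' ?_
    filter_upwards [hrpos] with s hs
    rw [smul_smul, inv_mul_cancel₀ hs.ne', one_smul]
  · have h1 : Tendsto (fun s => α s ^ s * w s * (w s)⁻¹) (𝓝[>] 0) (𝓝 β₀) := by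
      simpa using hm2.mul (hw1.inv₀ one_ne_zero)
    refine h1.congr' ?_
    filter_upwards [hwpos] with s hs
    rw [mul_assoc, mul_inv_cancel₀ hs.ne', mul_one]

/-- Off a neighbourhood of its boundary, the gauge of an ellipsoid stays away from `1`. -/
lemma exists_gauge_gap {A : Matrix (Fin d) (Fin d) ℝ} (hA : A.PosDef) (a : Ed d) {U : Set (Ed d)}
    (hU : IsOpen U)
    (hfr : frontier {x : Ed d | ‖Matrix.toEuclideanLin A⁻¹ (x - a)‖ ≤ 1} ⊆ U) :
    ∃ η > 0, ∀ x ∈ Uᶜ, η ≤ |‖Matrix.toEuclideanLin A⁻¹ (x - a)‖ - 1| := by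
  set g : Ed d → ℝ := fun x => ‖Matrix.toEuclideanLin A⁻¹ (x - a)‖ with hg
  have hgc : Continuous g := ((continuous_toEuclideanLin A⁻¹).comp (by fun_prop)).norm
  have hgA : ∀ z, g (Matrix.toEuclideanLin A z + a) = ‖z‖ := fun z => by
    simp only [hg, add_sub_cancel_right, toEuclideanLin_inv_apply hA]
  have hsphere : ∀ x, g x = 1 → x ∈ U := by
    intro x hx
    refine hfr ⟨subset_closure hx.le, fun hint => ?_⟩
    set z := Matrix.toEuclideanLin A⁻¹ (x - a) with hz
    have hxz : Matrix.toEuclideanLin A ((1 : ℝ) • z) + a = x := by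
      rw [one_smul, hz, toEuclideanLin_apply_inv hA, sub_add_cancel]
    have hcurve : Continuous fun t : ℝ => Matrix.toEuclideanLin A (t • z) + a :=
      ((continuous_toEuclideanLin A).comp (by fun_prop)).add continuous_const
    have hev : ∀ᶠ t : ℝ in 𝓝 1, g (Matrix.toEuclideanLin A (t • z) + a) ≤ 1 := by
      have hn : {y | g y ≤ 1} ∈ 𝓝 (Matrix.toEuclideanLin A ((1 : ℝ) • z) + a) := by
        rw [hxz]
        exact mem_interior_iff_mem_nhds.1 hint
      exact hcurve.continuousAt.eventually_mem hn
    obtain ⟨t, ht, ht1⟩ := ((hev.filter_mono nhdsWithin_le_nhds).and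
      (self_mem_nhdsWithin (a := (1 : ℝ)) (s := Set.Ioi 1))).exists
    have ht1 : 1 < t := ht1
    have hzn : ‖z‖ = 1 := hx
    rw [hgA, norm_smul, hzn, mul_one, Real.norm_of_nonneg (by linarith)] at ht
    linarith
  have hK : IsCompact (Uᶜ ∩ {x | g x ≤ 2}) := by
    have h1 : IsCompact ((fun z => Matrix.toEuclideanLin A z + a) '' Metric.closedBall 0 2) :=
      (isCompact_closedBall _ _).image ((continuous_toEuclideanLin A).add continuous_const)
    refine h1.of_isClosed_subset
      (hU.isClosed_compl.inter (isClosed_le hgc continuous_const)) fun x hx => ?_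
    refine ⟨Matrix.toEuclideanLin A⁻¹ (x - a), by simpa [hg] using hx.2, ?_⟩
    simp only [toEuclideanLin_apply_inv hA, sub_add_cancel]
  rcases (Uᶜ ∩ {x | g x ≤ 2}).eq_empty_or_nonempty with he | hne
  · refine ⟨1, one_pos, fun x hx => ?_⟩
    have : 2 < g x := by
      by_contra! hle
      exact Set.eq_empty_iff_forall_notMem.1 he x ⟨hx, hle⟩
    exact (by linarith : (1 : ℝ) ≤ g x - 1).trans (le_abs_self _)
  · obtain ⟨x₀, hx₀, hmin⟩ := hK.exists_isMinOn (f := fun x => |g x - 1|) hne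
      (by fun_prop)
    have hpos : 0 < |g x₀ - 1| :=
      abs_pos.2 (sub_ne_zero.2 fun h1 => hx₀.1 (hsphere x₀ h1))
    refine ⟨min 1 |g x₀ - 1|, lt_min one_pos hpos, fun x hx => ?_⟩
    rcases le_or_gt (g x) 2 with h2 | h2
    · exact (min_le_right _ _).trans (hmin ⟨hx, h2⟩)
    · exact (min_le_left _ _).trans
        ((by linarith : (1 : ℝ) ≤ g x - 1).trans (le_abs_self _))

lemma tendsto_matrix_inv {ι : Type*} {l : Filter ι} {A : ι → Matrix (Fin d) (Fin d) ℝ}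
    {A₀ : Matrix (Fin d) (Fin d) ℝ} (h₀ : A₀.det ≠ 0) (hA : Tendsto A l (𝓝 A₀)) :
    Tendsto (fun i => (A i)⁻¹) l (𝓝 A₀⁻¹) := by
  simp only [Matrix.inv_def, Ring.inverse_eq_inv']
  exact (((continuous_id.matrix_det).tendsto A₀).comp hA).inv₀ h₀ |>.smul
    (((continuous_id.matrix_adjugate).tendsto A₀).comp hA)

/-- Gauges of converging ellipsoids converge uniformly relative to `‖·‖ + 1`. -/
lemma tendsto_gauge {ι : Type*} {l : Filter ι} {A : ι → Matrix (Fin d) (Fin d) ℝ}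
    {A₀ : Matrix (Fin d) (Fin d) ℝ} {a : ι → Ed d} {a₀ : Ed d} (h₀ : A₀.PosDef)
    (hA : Tendsto A l (𝓝 A₀)) (ha : Tendsto a l (𝓝 a₀)) {δ : ℝ} (hδ : 0 < δ) :
    ∀ᶠ i in l, ∀ x : Ed d,
      |‖Matrix.toEuclideanLin (A i)⁻¹ (x - a i)‖ - ‖Matrix.toEuclideanLin A₀⁻¹ (x - a₀)‖| ≤
        δ * (‖Matrix.toEuclideanLin A₀⁻¹ (x - a₀)‖ + 1) := by
  have hinv := tendsto_matrix_inv h₀.det_pos.ne' hA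
  have hcont : Continuous (Matrix.toEuclideanCLM (n := Fin d) (𝕜 := ℝ)) :=
    LinearMap.continuous_of_finiteDimensional
      (Matrix.toEuclideanCLM (n := Fin d) (𝕜 := ℝ)).toAlgEquiv.toLinearMap
  have h1 : Tendsto (fun i => ‖Matrix.toEuclideanCLM (n := Fin d) (𝕜 := ℝ) ((A i)⁻¹ * A₀ - 1)‖) l (𝓝 0) := by
    have : Tendsto (fun i => (A i)⁻¹ * A₀ - 1) l (𝓝 0) := by
      have := (hinv.mul_const A₀).sub_const 1
      rwa [Matrix.nonsing_inv_mul _ h₀.det_pos.ne'.isUnit, sub_self] at this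
    simpa using ((hcont.tendsto 0).comp this).norm
  have h2 : Tendsto (fun i => ‖Matrix.toEuclideanLin (A i)⁻¹ (a₀ - a i)‖) l (𝓝 0) := by
    have hc : Tendsto (fun i => Matrix.toEuclideanCLM (n := Fin d) (𝕜 := ℝ) (A i)⁻¹) l
        (𝓝 (Matrix.toEuclideanCLM (n := Fin d) (𝕜 := ℝ) A₀⁻¹)) := (hcont.tendsto _).comp hinv
    have := ((isBoundedBilinearMap_apply.continuous.tendsto _).comp
      (hc.prodMk_nhds (ha.const_sub a₀))).norm
    simp only [sub_self, map_zero, norm_zero] at this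
    exact this
  filter_upwards [h1.eventually (ge_mem_nhds hδ), h2.eventually (ge_mem_nhds hδ)] with i hi1 hi2 x
  set z := Matrix.toEuclideanLin A₀⁻¹ (x - a₀) with hz
  have hx : x - a i = Matrix.toEuclideanLin A₀ z + (a₀ - a i) := by
    rw [hz, toEuclideanLin_apply_inv h₀]; abel
  have heq : Matrix.toEuclideanLin (A i)⁻¹ (x - a i) - z =
      Matrix.toEuclideanCLM (n := Fin d) (𝕜 := ℝ) ((A i)⁻¹ * A₀ - 1) z +
        Matrix.toEuclideanLin (A i)⁻¹ (a₀ - a i) := by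
    rw [hx, map_add, map_sub (Matrix.toEuclideanCLM (n := Fin d) (𝕜 := ℝ)), map_mul, map_one]
    change _ = Matrix.toEuclideanLin (A i)⁻¹ (Matrix.toEuclideanLin A₀ z) - z + _
    abel
  calc _ ≤ ‖Matrix.toEuclideanLin (A i)⁻¹ (x - a i) - z‖ := abs_norm_sub_norm_le _ _
    _ ≤ ‖Matrix.toEuclideanCLM (n := Fin d) (𝕜 := ℝ) ((A i)⁻¹ * A₀ - 1) z‖ +
        ‖Matrix.toEuclideanLin (A i)⁻¹ (a₀ - a i)‖ := by rw [heq]; exact norm_add_le _ _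
    _ ≤ δ * ‖z‖ + δ := by
      gcongr
      exact (ContinuousLinearMap.le_opNorm _ _).trans (by gcongr)
    _ = δ * (‖z‖ + 1) := by ring

lemma tendsto_const_rpow_half {κ : ℝ} (hκ : 0 < κ) :
    Tendsto (fun s : ℝ => κ ^ (s / 2)) (𝓝[>] 0) (𝓝 1) := by
  have : Continuous fun s : ℝ => κ ^ (s / 2) :=
    continuous_const.rpow (by fun_prop) fun _ => Or.inl hκ.ne'
  simpa using (this.tendsto 0).mono_left nhdsWithin_le_nhds

/-- Uniform convergence of powers of height functions of converging ellipsoids to a flat ellipsoid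
function, away from the boundary of the limit ellipsoid. -/
lemma tendstoUniformlyOn_heightFn_rpow {A : ℝ → Matrix (Fin d) (Fin d) ℝ} {α : ℝ → ℝ}
    {a : ℝ → Ed d} {A₀ : Matrix (Fin d) (Fin d) ℝ} {β₀ : ℝ} {a₀ : Ed d} (h₀ : A₀.PosDef)
    (hα : ∀ s, 0 < s → 0 < α s) (hA : Tendsto A (𝓝[>] 0) (𝓝 A₀))
    (hβ : Tendsto (fun s => α s ^ s) (𝓝[>] 0) (𝓝 β₀)) (ha : Tendsto a (𝓝[>] 0) (𝓝 a₀))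
    {U : Set (Ed d)} (hU : IsOpen U)
    (hfr : frontier {x : Ed d | ‖Matrix.toEuclideanLin A₀⁻¹ (x - a₀)‖ ≤ 1} ⊆ U) :
    TendstoUniformlyOn (fun s x => heightFn (A s) (α s) (a s) x ^ s) (flatFn A₀ β₀ a₀)
      (𝓝[>] 0) Uᶜ := by
  obtain ⟨η₀, hη₀, hgap₀⟩ := exists_gauge_gap h₀ a₀ hU hfr
  obtain ⟨η, hη, hη1, hηη⟩ : ∃ η : ℝ, 0 < η ∧ η ≤ 1 ∧ η ≤ η₀ :=
    ⟨min 1 η₀, lt_min one_pos hη₀, min_le_left _ _, min_le_right _ _⟩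
  set κ : ℝ := 1 - (1 - η / 2) ^ 2 with hκ
  have hκ0 : 0 < κ := by rw [hκ]; nlinarith
  have hlow : Tendsto (fun s => α s ^ s * κ ^ (s / 2)) (𝓝[>] 0) (𝓝 β₀) := by
    simpa using hβ.mul (tendsto_const_rpow_half hκ0)
  rw [Metric.tendstoUniformlyOn_iff]
  intro ε hε
  filter_upwards [tendsto_gauge h₀ hA ha (δ := η / 4) (by positivity),
    hlow.eventually (lt_mem_nhds (sub_lt_self β₀ hε)),
    hβ.eventually (gt_mem_nhds (lt_add_of_pos_right β₀ hε)), self_mem_nhdsWithin]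
    with s hgauge hs1 hs2 (hs : 0 < s) x hx
  have hgap := hηη.trans (hgap₀ x hx)
  have hclose := hgauge x
  unfold flatFn heightFn
  set u₀ := ‖Matrix.toEuclideanLin A₀⁻¹ (x - a₀)‖ with hu₀
  set u := ‖Matrix.toEuclideanLin (A s)⁻¹ (x - a s)‖ with hu
  have hunn : 0 ≤ u := norm_nonneg _
  obtain ⟨hc1, hc2⟩ := abs_le.1 hclose
  rcases le_or_gt u₀ 1 with h1 | h1
  · rw [abs_of_nonpos (by linarith)] at hgap
    have hu2 : u ≤ 1 - η / 2 := by nlinarith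
    have hu1 : u ≤ 1 := by linarith
    rw [if_pos h1, if_pos hu1, Real.mul_rpow (hα s hs).le (Real.sqrt_nonneg _),
      Real.sqrt_eq_rpow, ← Real.rpow_mul (by nlinarith)]
    have hαs : 0 < α s ^ s := Real.rpow_pos_of_pos (hα s hs) _
    have e1 : κ ^ (s / 2) ≤ (1 - u ^ 2) ^ (1 / 2 * s) := by
      rw [show 1 / 2 * s = s / 2 by ring]
      exact Real.rpow_le_rpow hκ0.le (by rw [hκ]; nlinarith) (by positivity)
    have e2 : (1 - u ^ 2) ^ (1 / 2 * s) ≤ 1 :=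
      Real.rpow_le_one (by nlinarith) (by nlinarith) (by positivity)
    rw [Real.dist_eq, abs_sub_lt_iff]
    constructor <;> nlinarith
  · rw [abs_of_pos (by linarith)] at hgap
    have hu1 : ¬ u ≤ 1 := by
      push Not
      nlinarith
    rw [if_neg (not_le.2 h1), if_neg hu1, Real.zero_rpow hs.ne', dist_self]
    exact hε

end JohnFunctions

/-- **The John ellipsoid of Alonso-Gutiérrez et al. is the John `0`-ellipsoid**
(Theorem 6.4). -/
theorem john_zero_ellipsoid (d : ℕ) (hd : 1 ≤ d)
    (f : Ed d → ℝ) (hf : ProperLogConcave f) :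
    ∃ (A : Matrix (Fin d) (Fin d) ℝ) (α : ℝ) (a : Ed d),
      A.PosDef ∧ 0 < α ∧
      (∀ x, flatFn A α a x ≤ f x) ∧
      (∀ J : ℝ → Ed d → ℝ, (∀ s : ℝ, 0 < s → IsJohnFn s f (J s)) →
        ∀ U : Set (Ed d), IsOpen U →
          frontier {x : Ed d | ‖Matrix.toEuclideanLin A⁻¹ (x - a)‖ ≤ 1} ⊆ U →
          TendstoUniformlyOn (fun s x => J s x) (flatFn A α a)
            (nhdsWithin (0 : ℝ) (Set.Ioi 0)) Uᶜ) ∧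
      (∀ (A' : Matrix (Fin d) (Fin d) ℝ) (α' : ℝ) (a' : Ed d),
        A'.PosDef → 0 < α' → (∀ x, flatFn A' α' a' x ≤ f x) →
          (∫ x, flatFn A' α' a' x) ≤ ∫ x, flatFn A α a x) ∧
      (∀ (A' : Matrix (Fin d) (Fin d) ℝ) (α' : ℝ) (a' : Ed d),
        A'.PosDef → 0 < α' → (∀ x, flatFn A' α' a' x ≤ f x) →
          (∫ x, flatFn A' α' a' x) = (∫ x, flatFn A α a x) →
          A' = A ∧ α' = α ∧ a' = a) := by
  obtain ⟨A, β, a, h⟩ := hf.exists_isFlatMax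
  have hvol := volume_closedBall_pos d
  refine ⟨A, β, a, h.posDef, h.pos, (flatFn_le_iff hf.1.1 h.posDef).2 h.below, ?_, ?_, ?_⟩
  · intro J hJ U hU hfr
    choose! B α b hJohn hJeq using hJ
    obtain ⟨h1, h2, h3⟩ := h.tendsto_john hf hJohn
    refine (tendstoUniformlyOn_heightFn_rpow h.posDef (fun s hs => (hJohn s hs).2.1) h1 h2 h3 hU
      hfr).congr ?_
    filter_upwards [self_mem_nhdsWithin] with s hs x _
    rw [hJeq s hs]
  · intro A' α' a' hA' hα' hle
    rw [integral_flatFn hA', integral_flatFn h.posDef]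
    exact mul_le_mul_of_nonneg_right
      (h.max A' α' a' hA' hα' ((flatFn_le_iff hf.1.1 hA').1 hle)) hvol.le
  · intro A' α' a' hA' hα' hle heq
    rw [integral_flatFn hA', integral_flatFn h.posDef] at heq
    exact h.unique hf.1 hA' hα' ((flatFn_le_iff hf.1.1 hA').1 hle)
      (mul_right_cancel₀ hvol.ne' heq)
end
end

section
/- Fix β_1, β_2 > 0 with β_1 + β_2 = 1. Let f_1, f_2 be proper log-concave functions on ℝ^d, and let G_1 = G[(A_1⊕α_1, a_1)] and G_2 = G[(A_2⊕α_2, a_2)] be Gaussian densities with G_1 ≤ f_1 and G_2 ≤ f_2 pointwise. Set f = (β_1 ∗ f_1) ⋆ (β_2 ∗ f_2) (Asplund sum of epi-products), A = β_1 A_1 + β_2 A_2, α = α_1^{β_1} α_2^{β_2}, a = β_1 a_1 + β_2 a_2. Then G[(A⊕α, a)] ≤ f pointwise, and ∫_{ℝ^d} G[(A⊕α, a)] ≥ (∫_{ℝ^d} G_1)^{β_1} · (∫_{ℝ^d} G_2)^{β_2}, with equality if and only if A_1 = A_2. -/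
open MeasureTheory
open scoped BigOperators RealInnerProductSpace

noncomputable section

open Matrix in
/-- Strict form of the Minkowski-type inequality `det M ^ b ≤ det (a • 1 + b • M)`. -/
theorem Matrix.PosDef.det_rpow_lt_det_smul_one_add_smul {n : Type*} [Fintype n] [DecidableEq n]
    {M : Matrix n n ℝ} (hM : M.PosDef) (hM1 : M ≠ 1) {a b : ℝ} (ha : 0 < a) (hb : 0 < b)
    (hab : a + b = 1) : M.det ^ b < (a • (1 : Matrix n n ℝ) + b • M).det := by
  set U := hM.1.eigenvectorUnitary
  set l := hM.1.eigenvalues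
  have hl : ∀ i, 0 < l i := hM.eigenvalues_pos
  have hUU : (U : Matrix n n ℝ) * star (U : Matrix n n ℝ) = 1 := Unitary.coe_mul_star_self U
  have hspec : M = (U : Matrix n n ℝ) * diagonal l * star (U : Matrix n n ℝ) := by
    have := hM.1.spectral_theorem
    rw [Unitary.conjStarAlgAut_apply] at this
    exact this
  have hdetU : (U : Matrix n n ℝ).det * (star (U : Matrix n n ℝ)).det = 1 := by
    rw [← det_mul, hUU, det_one]
  have hdet : (a • (1 : Matrix n n ℝ) + b • M).det = ∏ i, (a + b * l i) := by
    have : a • (1 : Matrix n n ℝ) + b • M =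
        (U : Matrix n n ℝ) * diagonal (fun i => a + b * l i) * star (U : Matrix n n ℝ) := by
      have hd : diagonal (fun i => a + b * l i) = a • (1 : Matrix n n ℝ) + b • diagonal l := by
        ext i j
        by_cases h : i = j <;> simp [h]
      rw [hd, mul_add, add_mul]
      conv_lhs => rw [hspec]
      simp [hUU]
    rw [this, det_mul, det_mul, det_diagonal, mul_right_comm, hdetU, one_mul]
  have hdetM : M.det = ∏ i, l i := by
    simpa using hM.1.det_eq_prod_eigenvalues
  rw [hdet, hdetM, ← Real.finsetProd_rpow _ _ fun i _ => (hl i).le]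
  have key : ∀ i, l i ≠ 1 → l i ^ b < a + b * l i := fun i hi => by
    have := rpow_one_add_lt_one_add_mul_self (s := l i - 1) (by linarith [hl i])
      (sub_ne_zero.mpr hi) hb (by linarith)
    rw [add_sub_cancel] at this
    linarith
  have hle : ∀ i, l i ^ b ≤ a + b * l i := fun i => by
    by_cases hi : l i = 1
    · simp [hi, hab]
    · exact (key i hi).le
  obtain ⟨i, hi⟩ : ∃ i, l i ≠ 1 := by
    by_contra! h
    refine hM1 ?_
    rw [hspec, funext h, show (fun _ : n => (1 : ℝ)) = 1 from rfl, Pi.one_def, diagonal_one,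
      mul_one, hUU]
  exact Finset.prod_lt_prod (fun i _ => Real.rpow_pos_of_pos (hl i) b) (fun i _ => hle i)
    ⟨i, Finset.mem_univ i, key i hi⟩

open Matrix in
/-- The determinant is strictly log-concave on positive definite matrices. -/
theorem Matrix.PosDef.det_rpow_mul_det_rpow_lt {n : Type*} [Fintype n] [DecidableEq n]
    {A B : Matrix n n ℝ} (hA : A.PosDef) (hB : B.PosDef) (hAB : A ≠ B) {a b : ℝ} (ha : 0 < a)
    (hb : 0 < b) (hab : a + b = 1) : A.det ^ a * B.det ^ b < (a • A + b • B).det := by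
  obtain ⟨S, rfl⟩ : ∃ S : Matrix n n ℝ, A = Sᴴ * S := by
    open scoped MatrixOrder Matrix.Norms.L2Operator in
    exact CStarAlgebra.nonneg_iff_eq_star_mul_self.mp hA.posSemidef.nonneg
  have hS : IsUnit S.det := by
    have := hA.det_pos
    rw [det_mul] at this
    exact (right_ne_zero_of_mul this.ne').isUnit
  have hSH : IsUnit Sᴴ.det := by simpa using hS
  set M := S⁻¹ᴴ * B * S⁻¹
  have hM : M.PosDef := hB.conjTranspose_mul_mul_same
    (mulVec_injective_of_isUnit ((isUnit_nonsing_inv_iff).2 ((isUnit_iff_isUnit_det S).2 hS)))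
  have hBM : B = Sᴴ * M * S := by
    simp only [M, conjTranspose_nonsing_inv]
    rw [mul_assoc, nonsing_inv_mul_cancel_right _ _ hS, ← mul_assoc, mul_nonsing_inv _ hSH,
      one_mul]
  have hM1 : M ≠ 1 := fun h => hAB (by rw [hBM, h, mul_one])
  have hcomb : a • (Sᴴ * S) + b • B = Sᴴ * (a • 1 + b • M) * S := by
    conv_lhs => rw [hBM]
    simp [mul_add, add_mul]
  have hBdet : B.det = (Sᴴ * S).det * M.det := by
    rw [hBM]; simp only [det_mul]; ring
  have hdetc : (Sᴴ * (a • 1 + b • M) * S).det = (Sᴴ * S).det * (a • 1 + b • M).det := by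
    simp only [det_mul]; ring
  rw [hcomb, hBdet, Real.mul_rpow hA.det_pos.le hM.det_pos.le, ← mul_assoc,
    ← Real.rpow_add hA.det_pos, hab, Real.rpow_one, hdetc]
  exact mul_lt_mul_of_pos_left (hM.det_rpow_lt_det_smul_one_add_smul hM1 ha hb hab) hA.det_pos

/-- The integral of a Gaussian density. -/
theorem integral_gaussFn {d : ℕ} {A : Matrix (Fin d) (Fin d) ℝ} (hA : A.PosDef) (α : ℝ)
    (a : Ed d) : ∫ x, gaussFn A α a x = α * Real.pi ^ (d / 2 : ℝ) * A.det := by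
  have hdet := hA.det_pos
  have hdet' : LinearMap.det (Matrix.toEuclideanLin A⁻¹) = A.det⁻¹ := by
    rw [LinearMap.det_toLpLin, Matrix.det_nonsing_inv, Ring.inverse_eq_inv']
  have hne : LinearMap.det (Matrix.toEuclideanLin A⁻¹) ≠ 0 := by
    rw [hdet']; exact (inv_pos.2 hdet).ne'
  set L := Matrix.toEuclideanLin A⁻¹
  have hL : Continuous L := L.continuous_of_finiteDimensional
  have hcont : Continuous fun v : Ed d => Real.exp (-‖v‖ ^ 2) := by fun_prop
  have h1 : ∫ x, Real.exp (-‖L x‖ ^ 2) = A.det * Real.pi ^ (d / 2 : ℝ) := by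
    rw [← integral_map (μ := volume) (φ := L) (f := fun v => Real.exp (-‖v‖ ^ 2))
        hL.aemeasurable hcont.aestronglyMeasurable,
      Measure.map_linearMap_addHaar_eq_smul_addHaar _ hne, integral_smul_measure, hdet', inv_inv,
      abs_of_pos hdet, ENNReal.toReal_ofReal hdet.le, smul_eq_mul]
    have := GaussianFourier.integral_rexp_neg_mul_sq_norm (V := Ed d) one_pos
    simp only [neg_mul, one_mul, div_one, finrank_euclideanSpace, Fintype.card_fin] at this
    rw [this]
  simp only [gaussFn]
  rw [integral_const_mul, integral_sub_right_eq_self (fun x => Real.exp (-‖L x‖ ^ 2)) a, h1]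
  ring

theorem gaussFn_pos {d : ℕ} (A : Matrix (Fin d) (Fin d) ℝ) {α : ℝ} (hα : 0 < α) (a x : Ed d) :
    0 < gaussFn A α a x :=
  mul_pos hα (Real.exp_pos _)

theorem continuous_gaussFn {d : ℕ} (A : Matrix (Fin d) (Fin d) ℝ) (α : ℝ) (a : Ed d) :
    Continuous (gaussFn A α a) := by
  have hL : Continuous (Matrix.toEuclideanLin A⁻¹) := LinearMap.continuous_of_finiteDimensional _
  unfold gaussFn
  fun_prop

/-- A log-concave function of finite integral that dominates a positive continuous function is
bounded. -/
theorem IsLogConcave.bddAbove_range {d : ℕ} {f g : Ed d → ℝ} (hf : IsLogConcave f)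
    (hint : ∫⁻ x, ENNReal.ofReal (f x) < ⊤) (hg : Continuous g) (hg0 : ∀ x, 0 < g x)
    (hgf : ∀ x, g x ≤ f x) : BddAbove (Set.range f) := by
  obtain ⟨y₀, -, hy₀⟩ := (isCompact_closedBall (0 : Ed d) 1).exists_isMinOn
    ⟨0, by simp⟩ hg.continuousOn
  set c := g y₀
  have hc : 0 < c := hg0 y₀
  have hcf : ∀ y ∈ Metric.closedBall (0 : Ed d) 1, c ≤ f y := fun y hy =>
    (hy₀ hy).trans (hgf y)
  set V := volume (Metric.closedBall (0 : Ed d) (1 / 2))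
  have hV0 : V ≠ 0 := (Metric.measure_closedBall_pos volume _ (by norm_num)).ne'
  have hVtop : V ≠ ⊤ := measure_closedBall_lt_top.ne
  have hV : 0 < V.toReal := ENNReal.toReal_pos hV0 hVtop
  set I := ∫⁻ x, ENNReal.ofReal (f x)
  have key : ∀ x, (f x ^ (1 / 2 : ℝ) * c ^ (1 / 2 : ℝ)) * V.toReal ≤ I.toReal := by
    intro x
    set m := f x ^ (1 / 2 : ℝ) * c ^ (1 / 2 : ℝ)
    have hm : 0 ≤ m := mul_nonneg (Real.rpow_nonneg (hf.1 x) _) (Real.rpow_nonneg hc.le _)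
    have hball : ∀ z ∈ Metric.closedBall ((1 / 2 : ℝ) • x) (1 / 2), m ≤ f z := by
      intro z hz
      have hy : (2 : ℝ) • (z - (1 / 2 : ℝ) • x) ∈ Metric.closedBall (0 : Ed d) 1 := by
        rw [mem_closedBall_iff_norm] at hz
        rw [mem_closedBall_zero_iff, norm_smul, Real.norm_of_nonneg two_pos.le]
        linarith
      have h := hf.2 x ((2 : ℝ) • (z - (1 / 2 : ℝ) • x)) (1 / 2) (by norm_num) (by norm_num)
      have hz' : (1 / 2 : ℝ) • x + (1 - 1 / 2 : ℝ) • (2 : ℝ) • (z - (1 / 2 : ℝ) • x) = z := by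
        module
      rw [hz', show (1 - 1 / 2 : ℝ) = 1 / 2 by norm_num] at h
      exact le_trans (mul_le_mul_of_nonneg_left
        (Real.rpow_le_rpow hc.le (hcf _ hy) (by norm_num)) (Real.rpow_nonneg (hf.1 x) _)) h
    have hlow : ENNReal.ofReal m * V ≤ I := by
      calc ENNReal.ofReal m * V
          = ENNReal.ofReal m * volume (Metric.closedBall ((1 / 2 : ℝ) • x) (1 / 2)) := by
            rw [Measure.addHaar_closedBall_center]
        _ = ∫⁻ _ in Metric.closedBall ((1 / 2 : ℝ) • x) (1 / 2), ENNReal.ofReal m := by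
            rw [setLIntegral_const]
        _ ≤ ∫⁻ z in Metric.closedBall ((1 / 2 : ℝ) • x) (1 / 2), ENNReal.ofReal (f z) :=
            setLIntegral_mono' measurableSet_closedBall fun z hz =>
              ENNReal.ofReal_le_ofReal (hball z hz)
        _ ≤ I := setLIntegral_le_lintegral _ _
    have := ENNReal.toReal_mono hint.ne hlow
    rwa [ENNReal.toReal_mul, ENNReal.toReal_ofReal hm] at this
  refine ⟨(I.toReal / V.toReal / c ^ (1 / 2 : ℝ)) ^ 2, ?_⟩
  rintro _ ⟨x, rfl⟩
  have hroot : f x ^ (1 / 2 : ℝ) ≤ I.toReal / V.toReal / c ^ (1 / 2 : ℝ) := by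
    rw [le_div_iff₀ (Real.rpow_pos_of_pos hc _), le_div_iff₀ hV]
    exact key x
  calc f x = (f x ^ (1 / 2 : ℝ)) ^ 2 := by
        rw [← Real.rpow_natCast, ← Real.rpow_mul (hf.1 x)]; norm_num
    _ ≤ _ := pow_le_pow_left₀ (Real.rpow_nonneg (hf.1 x) _) hroot 2

/-- A lower bound for the Asplund sum of epi-products of bounded functions. -/
theorem rpow_mul_rpow_le_asplund_epiProd {d : ℕ} {f g : Ed d → ℝ} (hf0 : ∀ x, 0 ≤ f x)
    (hg0 : ∀ x, 0 ≤ g x) (hf : BddAbove (Set.range f)) (hg : BddAbove (Set.range g)) {b c : ℝ}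
    (hb : 0 < b) (hc : 0 < c) (y z : Ed d) :
    f y ^ b * g z ^ c ≤ asplund (epiProd b f) (epiProd c g) (b • y + c • z) := by
  obtain ⟨M, hM⟩ := hf
  obtain ⟨N, hN⟩ := hg
  have hbdd : BddAbove (Set.range fun w : Ed d =>
      epiProd b f w * epiProd c g (b • y + c • z - w)) := by
    refine ⟨M ^ b * N ^ c, ?_⟩
    rintro _ ⟨w, rfl⟩
    exact mul_le_mul (Real.rpow_le_rpow (hf0 _) (hM ⟨_, rfl⟩) hb.le)
      (Real.rpow_le_rpow (hg0 _) (hN ⟨_, rfl⟩) hc.le) (Real.rpow_nonneg (hg0 _) _)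
      (Real.rpow_nonneg ((hf0 0).trans (hM ⟨0, rfl⟩)) _)
  refine le_trans (le_of_eq ?_) (le_ciSup hbdd (b • y))
  simp [epiProd, inv_smul_smul₀ hb.ne', inv_smul_smul₀ hc.ne']

/-- The interpolated Gaussian is a product of powers of values of the two given Gaussians. -/
theorem exists_gaussFn_smul_add_smul_eq {d : ℕ} {β₁ β₂ : ℝ} (hβ₁ : 0 < β₁) (hβ₂ : 0 < β₂)
    (hβ : β₁ + β₂ = 1) {A₁ A₂ : Matrix (Fin d) (Fin d) ℝ} {α₁ α₂ : ℝ} (a₁ a₂ : Ed d)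
    (hA₁ : A₁.PosDef) (hA₂ : A₂.PosDef) (hα₁ : 0 < α₁) (hα₂ : 0 < α₂) (x : Ed d) :
    ∃ y z, β₁ • y + β₂ • z = x ∧
      gaussFn (β₁ • A₁ + β₂ • A₂) (α₁ ^ β₁ * α₂ ^ β₂) (β₁ • a₁ + β₂ • a₂) x =
        gaussFn A₁ α₁ a₁ y ^ β₁ * gaussFn A₂ α₂ a₂ z ^ β₂ := by
  have cancel : ∀ B : Matrix (Fin d) (Fin d) ℝ, B.PosDef → ∀ w : Ed d,
      Matrix.toEuclideanLin B⁻¹ (Matrix.toEuclideanLin B w) = w ∧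
      Matrix.toEuclideanLin B (Matrix.toEuclideanLin B⁻¹ w) = w := fun B hB w => by
    have hu := hB.det_pos.ne'.isUnit
    constructor <;>
    · rw [← LinearMap.comp_apply, ← Matrix.toLpLin_mul]
      simp [Matrix.nonsing_inv_mul _ hu, Matrix.mul_nonsing_inv _ hu]
  have hA : (β₁ • A₁ + β₂ • A₂).PosDef := (hA₁.smul hβ₁).add (hA₂.smul hβ₂)
  obtain ⟨w, hw⟩ : ∃ w, w = Matrix.toEuclideanLin (β₁ • A₁ + β₂ • A₂)⁻¹
    (x - (β₁ • a₁ + β₂ • a₂)) := ⟨_, rfl⟩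
  refine ⟨Matrix.toEuclideanLin A₁ w + a₁, Matrix.toEuclideanLin A₂ w + a₂, ?_, ?_⟩
  · have h := (cancel _ hA (x - (β₁ • a₁ + β₂ • a₂))).2
    rw [← hw, map_add, map_smul, map_smul, LinearMap.add_apply, LinearMap.smul_apply,
      LinearMap.smul_apply] at h
    rw [← sub_eq_zero, ← sub_eq_zero.2 h]
    module
  · simp only [gaussFn, add_sub_cancel_right, (cancel _ hA₁ w).1, (cancel _ hA₂ w).1, ← hw]
    rw [Real.mul_rpow hα₁.le (Real.exp_pos _).le, Real.mul_rpow hα₂.le (Real.exp_pos _).le,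
      mul_mul_mul_comm, ← Real.rpow_add (Real.exp_pos _), hβ, Real.rpow_one]

/-- **Interpolation between Gaussians** (Lemma 7.2). -/
theorem interpolation_gaussians (d : ℕ)
    (β₁ β₂ : ℝ) (hβ₁ : 0 < β₁) (hβ₂ : 0 < β₂) (hβ : β₁ + β₂ = 1)
    (f₁ f₂ : Ed d → ℝ) (hf₁ : ProperLogConcave f₁) (hf₂ : ProperLogConcave f₂)
    (A₁ A₂ : Matrix (Fin d) (Fin d) ℝ) (α₁ α₂ : ℝ) (a₁ a₂ : Ed d)
    (hA₁ : A₁.PosDef) (hA₂ : A₂.PosDef) (hα₁ : 0 < α₁) (hα₂ : 0 < α₂)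
    (h₁ : ∀ x, gaussFn A₁ α₁ a₁ x ≤ f₁ x) (h₂ : ∀ x, gaussFn A₂ α₂ a₂ x ≤ f₂ x) :
    (∀ x, gaussFn (β₁ • A₁ + β₂ • A₂) (α₁ ^ β₁ * α₂ ^ β₂) (β₁ • a₁ + β₂ • a₂) x ≤
        asplund (epiProd β₁ f₁) (epiProd β₂ f₂) x) ∧
    (∫ x, gaussFn A₁ α₁ a₁ x) ^ β₁ * (∫ x, gaussFn A₂ α₂ a₂ x) ^ β₂ ≤
      (∫ x, gaussFn (β₁ • A₁ + β₂ • A₂) (α₁ ^ β₁ * α₂ ^ β₂) (β₁ • a₁ + β₂ • a₂) x) ∧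
    ((∫ x, gaussFn (β₁ • A₁ + β₂ • A₂) (α₁ ^ β₁ * α₂ ^ β₂) (β₁ • a₁ + β₂ • a₂) x) =
        (∫ x, gaussFn A₁ α₁ a₁ x) ^ β₁ * (∫ x, gaussFn A₂ α₂ a₂ x) ^ β₂ ↔
      A₁ = A₂) := by
  refine ⟨fun x => ?_, ?_⟩
  · obtain ⟨y, z, rfl, h⟩ :=
      exists_gaussFn_smul_add_smul_eq hβ₁ hβ₂ hβ a₁ a₂ hA₁ hA₂ hα₁ hα₂ x
    rw [h]
    have hb₁ := hf₁.1.bddAbove_range hf₁.2.2.2 (continuous_gaussFn A₁ α₁ a₁)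
      (gaussFn_pos A₁ hα₁ a₁) h₁
    have hb₂ := hf₂.1.bddAbove_range hf₂.2.2.2 (continuous_gaussFn A₂ α₂ a₂)
      (gaussFn_pos A₂ hα₂ a₂) h₂
    refine le_trans ?_ (rpow_mul_rpow_le_asplund_epiProd hf₁.1.1 hf₂.1.1 hb₁ hb₂ hβ₁ hβ₂ y z)
    have p₁ := (gaussFn_pos A₁ hα₁ a₁ y).le
    have p₂ := (gaussFn_pos A₂ hα₂ a₂ z).le
    gcongr
    · exact Real.rpow_nonneg (hf₁.1.1 y) _
    · exact h₁ y
    · exact h₂ z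
  have hA : (β₁ • A₁ + β₂ • A₂).PosDef := (hA₁.smul hβ₁).add (hA₂.smul hβ₂)
  rw [integral_gaussFn hA, integral_gaussFn hA₁, integral_gaussFn hA₂]
  set c := Real.pi ^ (d / 2 : ℝ)
  have hc : 0 < c := Real.rpow_pos_of_pos Real.pi_pos _
  have hk : 0 < α₁ ^ β₁ * α₂ ^ β₂ * c := by positivity
  have hprod : (α₁ * c * A₁.det) ^ β₁ * (α₂ * c * A₂.det) ^ β₂ =
      α₁ ^ β₁ * α₂ ^ β₂ * c * (A₁.det ^ β₁ * A₂.det ^ β₂) := by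
    have hcc : c ^ β₁ * c ^ β₂ = c := by rw [← Real.rpow_add hc, hβ, Real.rpow_one]
    rw [Real.mul_rpow (by positivity) hA₁.det_pos.le, Real.mul_rpow (by positivity) hA₂.det_pos.le,
      Real.mul_rpow hα₁.le hc.le, Real.mul_rpow hα₂.le hc.le]
    linear_combination α₁ ^ β₁ * α₂ ^ β₂ * (A₁.det ^ β₁ * A₂.det ^ β₂) * hcc
  rw [hprod, mul_le_mul_iff_right₀ hk, mul_right_inj' hk.ne']
  by_cases h : A₁ = A₂
  · subst h
    have : (β₁ • A₁ + β₂ • A₁).det = A₁.det ^ β₁ * A₁.det ^ β₂ := by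
      rw [← add_smul, ← Real.rpow_add hA₁.det_pos, hβ, one_smul, Real.rpow_one]
    exact ⟨this.ge, iff_of_true this rfl⟩
  · have := hA₁.det_rpow_mul_det_rpow_lt hA₂ h hβ₁ hβ₂ hβ
    exact ⟨this.le, iff_of_false this.ne' h⟩
end
end
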